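/- Let Γ be a finite simplicial graph satisfying property (B) (i.e. both (B1) and (B2)). If G is a finite-index subgroup of Aut(A_Γ) that contains the Torelli group IA_Γ, then every group homomorphism from G to ℤ is trivial (equivalently, H¹(G, ℤ) = 0). -/

import Mathlib

open SimpleGraph

namespace RaagPaper

variable {V : Type} [Fintype V] [DecidableEq V]

/-- The defining relations of the right-angled Artin group of a graph `Γ`. -/
def Rels (Γ : SimpleGraph V) : Set (FreeGroup V) :=
  {r | ∃ u v : V, Γ.Adj u v ∧
    r = FreeGroup.of u * FreeGroup.of v * (FreeGroup.of u)⁻¹ * (FreeGroup.of v)⁻¹}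

/-- The right-angled Artin group of `Γ`. -/
abbrev Raag (Γ : SimpleGraph V) := PresentedGroup (Rels Γ)

/-- The generator of `Raag Γ` corresponding to the vertex `v`. -/
def gen (Γ : SimpleGraph V) (v : V) : Raag Γ := PresentedGroup.of v

/-- The link of a vertex. -/
def lk (Γ : SimpleGraph V) (v : V) : Set V := Γ.neighborSet v

/-- The star of a vertex. -/
def st (Γ : SimpleGraph V) (v : V) : Set V := insert v (Γ.neighborSet v)

/-- The partial preorder `v ≤ w ↔ lk v ⊆ st w` on vertices. -/
def Le (Γ : SimpleGraph V) (v w : V) : Prop := lk Γ v ⊆ st Γ w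

/-- The equivalence `v ∼ w`. -/
def Sim (Γ : SimpleGraph V) (v w : V) : Prop := Le Γ v w ∧ Le Γ w v

/-- The equivalence class of a vertex under `∼`. -/
def simClass (Γ : SimpleGraph V) (v : V) : Set V := {u | Sim Γ u v}

/-- Property (B1): any two distinct non-adjacent vertices are `∼`-equivalent. -/
def B1 (Γ : SimpleGraph V) : Prop :=
  ∀ u v : V, u ≠ v → ¬ Γ.Adj u v → Sim Γ u v

/-- Property (B2). -/
def B2 (Γ : SimpleGraph V) : Prop :=
  ∀ v w : V, v ≠ w → Le Γ v w → ∃ u : V, u ≠ v ∧ u ≠ w ∧ Le Γ v u ∧ Le Γ u w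

/-- `α` is the transvection `t_{vw}` for some `v ≤ w`. -/
def IsTransvection (Γ : SimpleGraph V) (α : MulAut (Raag Γ)) : Prop :=
  ∃ v w : V, v ≠ w ∧ Le Γ v w ∧ α (gen Γ v) = gen Γ v * gen Γ w ∧
    ∀ z : V, z ≠ v → α (gen Γ z) = gen Γ z

/-- `Y` is (the vertex set of) a connected component of the subgraph of `Γ` induced on `S`. -/
def IsCompOf (Γ : SimpleGraph V) (S : Set V) (Y : Set V) : Prop :=
  ∃ C : (Γ.induce S).ConnectedComponent, Y = Subtype.val '' C.supp

/-- `α` is a partial conjugation `c_{v,Y}`. -/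
def IsPartialConj (Γ : SimpleGraph V) (α : MulAut (Raag Γ)) : Prop :=
  ∃ (v : V) (Y : Set V), IsCompOf Γ (st Γ v)ᶜ Y ∧
    (∀ y ∈ Y, α (gen Γ y) = (gen Γ v)⁻¹ * gen Γ y * gen Γ v) ∧
    (∀ z : V, z ∉ Y → α (gen Γ z) = gen Γ z)

/-- `α` is the inversion `ι_v`. -/
def IsInversion (Γ : SimpleGraph V) (α : MulAut (Raag Γ)) : Prop :=
  ∃ v : V, α (gen Γ v) = (gen Γ v)⁻¹ ∧ ∀ z : V, z ≠ v → α (gen Γ z) = gen Γ z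

/-- `SAut⁰(A_Γ)`: the subgroup generated by transvections and partial conjugations. -/
def SAut0 (Γ : SimpleGraph V) : Subgroup (MulAut (Raag Γ)) :=
  Subgroup.closure {α | IsTransvection Γ α ∨ IsPartialConj Γ α}

/-- `Aut⁰(A_Γ)`: the subgroup generated by transvections, partial conjugations and inversions. -/
def Aut0 (Γ : SimpleGraph V) : Subgroup (MulAut (Raag Γ)) :=
  Subgroup.closure {α | IsTransvection Γ α ∨ IsPartialConj Γ α ∨ IsInversion Γ α}

/-- The natural map `Aut(A_Γ) → Aut(A_Γ^{ab})`. -/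
def abAutHom (Γ : SimpleGraph V) :
    MulAut (Raag Γ) →* MulAut (Abelianization (Raag Γ)) :=
  MonoidHom.mk' (fun e => MulEquiv.abelianizationCongr e) (by
    intro e f
    exact (abelianizationCongr_trans f e).symm)

/-- The Torelli subgroup `IA_Γ`. -/
def IA (Γ : SimpleGraph V) : Subgroup (MulAut (Raag Γ)) := (abAutHom Γ).ker

/-- The subgroup of `m`-th powers of `A_Γ^{ab}`; the quotient by it is `A_Γ^{ab} ⊗ ℤ/mℤ`. -/
def powN (Γ : SimpleGraph V) (m : ℕ) : Subgroup (Abelianization (Raag Γ)) :=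
  (powMonoidHom m : Abelianization (Raag Γ) →* Abelianization (Raag Γ)).range

/-- `IA_Γ(m)`: the kernel of `Aut(A_Γ) → Aut(A_Γ^{ab} ⊗ ℤ/mℤ)`, i.e. the automorphisms
acting trivially on the abelianization modulo `m`-th powers. -/
def IAm (Γ : SimpleGraph V) (m : ℕ) : Subgroup (MulAut (Raag Γ)) where
  carrier := {α | ∀ x : Abelianization (Raag Γ), abAutHom Γ α x * x⁻¹ ∈ powN Γ m}
  one_mem' := by
    intro x
    simp only [map_one, MulAut.one_apply, mul_inv_cancel]
    exact one_mem _
  mul_mem' := by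
    intro a b ha hb x
    have h : abAutHom Γ (a * b) x * x⁻¹ =
        (abAutHom Γ a (abAutHom Γ b x) * (abAutHom Γ b x)⁻¹) * (abAutHom Γ b x * x⁻¹) := by
      simp only [map_mul, MulAut.mul_apply]
      group
    rw [h]
    exact mul_mem (ha _) (hb x)
  inv_mem' := by
    intro a ha x
    have h : abAutHom Γ a (abAutHom Γ a⁻¹ x) = x := by
      have : abAutHom Γ a * abAutHom Γ a⁻¹ = 1 := by
        rw [← map_mul, mul_inv_cancel, map_one]
      calc abAutHom Γ a (abAutHom Γ a⁻¹ x) = (abAutHom Γ a * abAutHom Γ a⁻¹) x := rfl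
        _ = x := by rw [this]; rfl
    have := inv_mem (ha (abAutHom Γ a⁻¹ x))
    rw [h] at this
    simpa [mul_comm] using this
  
/-- `SIA_Γ(m) = SAut⁰(A_Γ) ∩ IA_Γ(m)`. -/
def SIA (Γ : SimpleGraph V) (m : ℕ) : Subgroup (MulAut (Raag Γ)) := SAut0 Γ ⊓ IAm Γ m

/-- The group of inner automorphisms of `A_Γ`. -/
def innSub (Γ : SimpleGraph V) : Subgroup (MulAut (Raag Γ)) :=
  (MulAut.conj : Raag Γ →* MulAut (Raag Γ)).range

/-- Property (NL): three pairwise distinct, pairwise non-adjacent vertices with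
`v₃ ≤ v₁` and `v₃ ≤ v₂`. -/
def NL (Γ : SimpleGraph V) : Prop :=
  ∃ v₁ v₂ v₃ : V, v₁ ≠ v₂ ∧ v₁ ≠ v₃ ∧ v₂ ≠ v₃ ∧
    ¬ Γ.Adj v₁ v₂ ∧ ¬ Γ.Adj v₁ v₃ ∧ ¬ Γ.Adj v₂ v₃ ∧ Le Γ v₃ v₁ ∧ Le Γ v₃ v₂

open Classical in
/-- The multiset of cardinalities of the equivalence classes of vertices under `∼`. -/
noncomputable def classSizes (Γ : SimpleGraph V) : Multiset ℕ :=
  (Finset.image (fun v => Set.toFinset (simClass Γ v)) Finset.univ).val.map Finset.card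

/-- A subgroup exhibiting its ambient group as virtually torsion-free abelian. -/
structure IsLatticeLike {Q : Type*} [Group Q] (T : Subgroup Q) : Prop where
  normal : T.Normal
  finiteIndex : T.FiniteIndex
  comm : ∀ a ∈ T, ∀ b ∈ T, a * b = b * a
  torsionFree : ∀ a ∈ T, IsOfFinOrder a → a = 1

namespace IsLatticeLike

variable {Q : Type*} [Group Q] {T : Subgroup Q}

theorem index_pos (hT : IsLatticeLike T) : 0 < T.index :=
  Nat.pos_of_ne_zero hT.finiteIndex.index_ne_zero

theorem pow_index_mem (hT : IsLatticeLike T) (q : Q) : q ^ T.index ∈ T :=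
  have := hT.normal
  Subgroup.pow_index_mem T q

theorem pow_index_eq_one (hT : IsLatticeLike T) {q : Q} (hq : IsOfFinOrder q) :
    q ^ T.index = 1 :=
  hT.torsionFree _ (hT.pow_index_mem q) hq.pow

theorem isOfFinOrder_iff (hT : IsLatticeLike T) {q : Q} : IsOfFinOrder q ↔ q ^ T.index = 1 :=
  ⟨hT.pow_index_eq_one, fun h => isOfFinOrder_iff_pow_eq_one.2 ⟨_, hT.index_pos, h⟩⟩

theorem finite_of_torsion (hT : IsLatticeLike T) {H : Subgroup Q}
    (h : ∀ x ∈ H, IsOfFinOrder x) : Finite H := by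
  have := hT.finiteIndex
  have := hT.normal
  refine Finite.of_injective (fun x : H => (QuotientGroup.mk' T) x) ?_
  intro x y hxy
  have hmem : (x : Q)⁻¹ * y ∈ T := QuotientGroup.eq.1 hxy
  have hone := hT.torsionFree _ hmem (h _ (H.mul_mem (H.inv_mem x.2) y.2))
  exact Subtype.ext (inv_mul_eq_one.1 hone)

/-- If conjugation by `a` multiplies `b` by `c`, where `c` commutes with `b` and is fixed by
conjugation by `a` up to `T`, then `c` is torsion. -/
theorem isOfFinOrder_of_conj_eq (hT : IsLatticeLike T) {a a' b c : Q}
    (hconj : a * b * a⁻¹ = c * b) (hcb : Commute c b) (ha : a'⁻¹ * a ∈ T)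
    (ha' : Commute a' c) : IsOfFinOrder c := by
  have hnormal := hT.normal
  set m := T.index
  have hβ : b ^ m ∈ T := hT.pow_index_mem b
  have hγ : c ^ m ∈ T := hT.pow_index_mem c
  have hstep : a * b ^ m * a⁻¹ = c ^ m * b ^ m := by
    rw [← conj_pow, hconj, hcb.mul_pow]
  have hfix : a * c ^ m * a⁻¹ = c ^ m := by
    have h1 : Commute (a'⁻¹ * a) (c ^ m) := hT.comm _ ha _ hγ
    have h2 : Commute (a' * (a'⁻¹ * a)) (c ^ m) := (ha'.pow_right m).mul_left h1
    rw [mul_inv_cancel_left] at h2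
    rw [h2.eq, mul_inv_cancel_right]
  have hiter : ∀ k : ℕ, a ^ k * b ^ m * (a ^ k)⁻¹ = (c ^ m) ^ k * b ^ m := by
    intro k
    induction k with
    | zero => simp
    | succ k ih =>
      calc a ^ (k + 1) * b ^ m * (a ^ (k + 1))⁻¹
          = a * (a ^ k * b ^ m * (a ^ k)⁻¹) * a⁻¹ := by rw [pow_succ']; group
        _ = (a * c ^ m * a⁻¹) ^ k * (a * b ^ m * a⁻¹) := by rw [ih, conj_pow]; group
        _ = (c ^ m) ^ (k + 1) * b ^ m := by rw [hfix, hstep, pow_succ, mul_assoc]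
  have hcomm := hT.comm _ (hT.pow_index_mem a) _ hβ
  have hone : (c ^ m) ^ m = 1 := by
    have h := hiter m
    rw [hcomm, mul_inv_cancel_right] at h
    exact mul_eq_right.1 h.symm
  exact isOfFinOrder_iff_pow_eq_one.2 ⟨m * m, Nat.mul_pos hT.index_pos hT.index_pos,
    by rw [pow_mul, hone]⟩

theorem finite_closure_of_commute (hT : IsLatticeLike T) {s : Set Q}
    (hs : ∀ x ∈ s, IsOfFinOrder x) (hcomm : ∀ x ∈ s, ∀ y ∈ s, Commute x y) :
    Finite (Subgroup.closure s) := by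
  refine hT.finite_of_torsion fun x hx => ?_
  let inst := Subgroup.isMulCommutative_closure (k := s) fun x hx y hy => hcomm x hx y hy
  induction hx using Subgroup.closure_induction with
  | mem x hx => exact hs x hx
  | one => exact IsOfFinOrder.one
  | mul x y hx hy ihx ihy =>
    have hxy : Commute x y :=
      congrArg Subtype.val (inst.is_comm.comm ⟨x, hx⟩ ⟨y, hy⟩)
    exact hxy.isOfFinOrder_mul ihx ihy
  | inv x _ ih => exact ih.inv

/-- A subgroup generated by torsion that normalizes two finite subgroups which together contain
it is finite. -/
theorem finite_closure_of_normalizes (hT : IsLatticeLike T) {s : Set Q} {P P' : Subgroup Q}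
    (hs : ∀ x ∈ s, IsOfFinOrder x) (hP : Finite P) (hP' : Finite P')
    (hn : Subgroup.closure s ≤ Subgroup.normalizer (P : Set Q))
    (hn' : Subgroup.closure s ≤ Subgroup.normalizer (P' : Set Q))
    (hle : Subgroup.closure s ≤ P ⊔ P') : Finite (Subgroup.closure s) := by
  have hnormal := hT.normal
  set L := Subgroup.closure s
  have key : ∀ R : Subgroup Q, Finite R → L ≤ Subgroup.normalizer (R : Set Q) → ∀ t ∈ L, t ∈ T →
      R ≤ Subgroup.centralizer {t} := by
    intro R hR hLR t htL htT r hr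
    have h1 : t * r * t⁻¹ * r⁻¹ ∈ R :=
      R.mul_mem ((Subgroup.mem_normalizer_iff.1 (hLR htL) r).1 hr) (R.inv_mem hr)
    have h2 : t * r * t⁻¹ * r⁻¹ ∈ T := by
      rw [mul_assoc t r, mul_assoc t]
      exact T.mul_mem htT (hnormal.conj_mem _ (T.inv_mem htT) r)
    have h3 : IsOfFinOrder (t * r * t⁻¹ * r⁻¹) :=
      Submonoid.isOfFinOrder_coe.2 (isOfFinOrder_of_finite (⟨_, h1⟩ : R))
    have h4 := hT.torsionFree _ h2 h3
    rw [Subgroup.mem_centralizer_singleton_iff]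
    rw [mul_inv_eq_one, mul_inv_eq_iff_eq_mul] at h4
    exact h4.symm
  have hcentral : T.subgroupOf L ≤ Subgroup.center L := by
    intro t ht
    rw [Subgroup.mem_subgroupOf] at ht
    rw [Subgroup.mem_center_iff]
    intro g
    have hg : (g : Q) ∈ Subgroup.centralizer {(t : Q)} :=
      (hle.trans (sup_le (key P hP hn t t.2 ht) (key P' hP' hn' t t.2 ht))) g.2
    rw [Subgroup.mem_centralizer_singleton_iff] at hg
    apply Subtype.ext
    exact hg
  have hfi := hT.finiteIndex
  have : (Subgroup.center L).FiniteIndex :=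
    Subgroup.finiteIndex_of_le hcentral
  have hall : ∀ x : Q, ∀ hx : x ∈ L, IsOfFinOrder (MonoidHom.transferCenterPow L ⟨x, hx⟩) := by
    intro x hx
    induction hx using Subgroup.closure_induction with
    | mem x hx =>
      exact MonoidHom.isOfFinOrder _ (Submonoid.isOfFinOrder_coe.1 (hs x hx))
    | one =>
      have : (⟨1, Subgroup.one_mem _⟩ : L) = 1 := rfl
      exact MonoidHom.isOfFinOrder _ (this ▸ IsOfFinOrder.one)
    | mul x y hx hy ihx ihy =>
      have : (⟨x * y, L.mul_mem hx hy⟩ : L) = ⟨x, hx⟩ * ⟨y, hy⟩ := rfl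
      rw [this, map_mul]
      exact Commute.isOfFinOrder_mul (mul_comm' _ _) ihx ihy
    | inv x hx ih =>
      have : (⟨x⁻¹, L.inv_mem hx⟩ : L) = ⟨x, hx⟩⁻¹ := rfl
      rw [this, map_inv]
      exact ih.inv
  refine hT.finite_of_torsion fun x hx => ?_
  have h := hall x hx
  rw [← Submonoid.isOfFinOrder_coe, MonoidHom.transferCenterPow_apply,
    ← Submonoid.isOfFinOrder_coe, Subgroup.coe_pow] at h
  exact h.of_pow (Subgroup.FiniteIndex.index_ne_zero)

end IsLatticeLike

section Pointwise

open Pointwise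

/-- In a finite group generated by two subgroups `A` and `B`, some power of the set `A * B` is
everything. -/
theorem exists_coe_mul_coe_pow_eq {Q : Type*} [Group Q] (A B : Subgroup Q)
    (hfin : Finite (A ⊔ B : Subgroup Q)) :
    ∃ N₀ : ℕ, ∀ N ≥ N₀, ((A : Set Q) * (B : Set Q)) ^ N = (A ⊔ B : Subgroup Q) := by
  have hone : (1 : Q) ∈ (A : Set Q) * (B : Set Q) := ⟨1, A.one_mem, 1, B.one_mem, mul_one 1⟩
  have hmono : Monotone fun N : ℕ => ((A : Set Q) * (B : Set Q)) ^ N :=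
    fun m n h => Set.pow_subset_pow_right hone h
  have hle : ∀ N : ℕ, ((A : Set Q) * (B : Set Q)) ^ N ⊆ (A ⊔ B : Subgroup Q) := by
    intro N
    induction N with
    | zero => simp [(A ⊔ B).one_mem]
    | succ N ih =>
      rw [pow_succ]
      rintro _ ⟨x, hx, _, ⟨a, ha, b, hb, rfl⟩, rfl⟩
      exact mul_mem (ih hx) (mul_mem ((le_sup_left : A ≤ A ⊔ B) ha)
        ((le_sup_right : B ≤ A ⊔ B) hb))
  have hex : ∀ x ∈ A ⊔ B, ∃ N : ℕ, x ∈ ((A : Set Q) * (B : Set Q)) ^ N := by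
    intro x hx
    rw [Subgroup.sup_eq_closure] at hx
    induction hx using Subgroup.closure_induction with
    | mem x hx =>
      refine ⟨1, ?_⟩
      rw [pow_one]
      rcases hx with hx | hx
      · exact ⟨x, hx, 1, B.one_mem, mul_one x⟩
      · exact ⟨1, A.one_mem, x, hx, one_mul x⟩
    | one => exact ⟨0, by simp⟩
    | mul x y _ _ ihx ihy =>
      obtain ⟨m, hm⟩ := ihx
      obtain ⟨n, hn⟩ := ihy
      exact ⟨m + n, by rw [pow_add]; exact Set.mul_mem_mul hm hn⟩
    | inv x _ ih =>
      obtain ⟨m, hm⟩ := ih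
      refine ⟨m + 1, ?_⟩
      have h1 : x⁻¹ ∈ ((B : Set Q) * (A : Set Q)) ^ m := by
        have : ((B : Set Q) * (A : Set Q)) ^ m = (((A : Set Q) * (B : Set Q)) ^ m)⁻¹ := by
          rw [← inv_pow, mul_inv_rev]; simp
        rw [this]
        simpa using hm
      have h2 : (A : Set Q) * ((B : Set Q) * (A : Set Q)) ^ m * B
          = ((A : Set Q) * (B : Set Q)) ^ (m + 1) := by
        have : SemiconjBy (A : Set Q) ((B : Set Q) * A) ((A : Set Q) * B) := by
          simp [SemiconjBy, mul_assoc]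
        rw [(this.pow_right m).eq, pow_succ, mul_assoc]
      rw [← h2]
      exact ⟨x⁻¹, ⟨1, A.one_mem, x⁻¹, h1, one_mul _⟩, 1, B.one_mem, mul_one _⟩
  choose! n hn using hex
  have hf : (((A ⊔ B : Subgroup Q) : Set Q)).Finite := Set.toFinite _
  refine ⟨hf.toFinset.sup n, fun N hN => Set.Subset.antisymm (hle N) fun x hx => ?_⟩
  exact hmono (le_trans (Finset.le_sup (hf.mem_toFinset.2 hx)) hN) (hn x hx)

theorem commute_coe_of_subset_normalizer {Q : Type*} [Group Q] {S : Set Q} {P : Subgroup Q}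
    (h : S ⊆ Subgroup.normalizer (P : Set Q)) : Commute S (P : Set Q) := by
  apply Set.Subset.antisymm
  · rintro _ ⟨s, hs, p, hp, rfl⟩
    exact ⟨s * p * s⁻¹, (Subgroup.mem_normalizer_iff.1 (h hs) p).1 hp, s, hs, by group⟩
  · rintro _ ⟨p, hp, s, hs, rfl⟩
    refine ⟨s, hs, s⁻¹ * p * s, ?_, by group⟩
    refine (Subgroup.mem_normalizer_iff.1 (h hs) _).2 ?_
    simpa [mul_assoc] using hp

/-- Tavgen's rank reduction: two finite subgroups `U`, `U'` which both split off a piece of the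
finite subgroup `A ⊔ B`, along subgroups normalized by it, have product powers absorbing
`A ⊔ B`. -/
theorem coe_mul_coe_pow_mul_sup {Q : Type*} [Group Q] {U U' A B P P' : Subgroup Q}
    (hU : (U : Set Q) = A * P) (hU' : (U' : Set Q) = B * P')
    (hP : A ⊔ B ≤ Subgroup.normalizer (P : Set Q))
    (hP' : A ⊔ B ≤ Subgroup.normalizer (P' : Set Q))
    (hfin : Finite (A ⊔ B : Subgroup Q)) :
    ∃ N₀ : ℕ, ∀ N ≥ N₀, ((U : Set Q) * (U' : Set Q)) ^ N * ((A ⊔ B : Subgroup Q) : Set Q)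
      = ((U : Set Q) * (U' : Set Q)) ^ N := by
  obtain ⟨N₀, h⟩ := exists_coe_mul_coe_pow_eq A B hfin
  refine ⟨N₀, fun N hN => ?_⟩
  have hAP : Commute (A : Set Q) (P : Set Q) :=
    commute_coe_of_subset_normalizer fun x hx => hP ((le_sup_left : A ≤ A ⊔ B) hx)
  have hAP' : Commute (A : Set Q) (P' : Set Q) :=
    commute_coe_of_subset_normalizer fun x hx => hP' ((le_sup_left : A ≤ A ⊔ B) hx)
  have hBP : Commute (B : Set Q) (P : Set Q) :=
    commute_coe_of_subset_normalizer fun x hx => hP ((le_sup_right : B ≤ A ⊔ B) hx)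
  have hBP' : Commute (B : Set Q) (P' : Set Q) :=
    commute_coe_of_subset_normalizer fun x hx => hP' ((le_sup_right : B ≤ A ⊔ B) hx)
  have hc : Commute ((P : Set Q) * P') ((A : Set Q) * B) :=
    ((hAP.mul_right hAP').mul_left (hBP.mul_right hBP')).symm
  have hprod : (U : Set Q) * U' = ((P : Set Q) * P') * ((A : Set Q) * B) := by
    rw [hU, hU', hAP.eq, mul_assoc, mul_assoc, ← mul_assoc (A : Set Q),
      (hAP'.mul_left hBP').eq]
  rw [hprod, hc.mul_pow, mul_assoc, h N hN, coe_mul_coe]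

theorem closure_le_normalizer_closure {Q : Type*} [Group Q] {s t : Set Q}
    (h : ∀ g ∈ s, ∀ p ∈ t, g * p * g⁻¹ ∈ Subgroup.closure t ∧ g⁻¹ * p * g ∈ Subgroup.closure t) :
    Subgroup.closure s ≤ Subgroup.normalizer (Subgroup.closure t : Set Q) := by
  have key : ∀ g : Q, (∀ p ∈ t, g * p * g⁻¹ ∈ Subgroup.closure t) →
      ∀ p ∈ Subgroup.closure t, g * p * g⁻¹ ∈ Subgroup.closure t := by
    intro g hg
    have : Subgroup.closure t ≤ (Subgroup.closure t).comap (MulAut.conj g).toMonoidHom :=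
      (Subgroup.closure_le _).2 hg
    exact fun p hp => this hp
  rw [Subgroup.closure_le]
  intro g hg
  refine Subgroup.mem_normalizer_iff.2 fun p => ⟨key g (fun p hp => (h g hg p hp).1) p, fun hp => ?_⟩
  have := key g⁻¹ (fun p hp => by simpa using (h g hg p hp).2) _ hp
  simpa [mul_assoc] using this

/-- Elements `x i j`, for `i ≠ j`, subject to the Steinberg relations over `ℤ`. -/
structure IsSteinberg {Q n : Type*} [Group Q] (x : n → n → Q) : Prop where
  commute : ∀ i j k l, i ≠ j → k ≠ l → j ≠ k → i ≠ l → Commute (x i j) (x k l)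
  rel : ∀ i j k, i ≠ j → j ≠ k → i ≠ k → x j k * x i j = x i j * x i k * x j k

/-- The subgroup generated by the root elements `x i j` with `R i j`. -/
def rootSubgroup {Q n : Type*} [Group Q] (x : n → n → Q) (R : n → n → Prop) : Subgroup Q :=
  Subgroup.closure {q | ∃ i j, i ≠ j ∧ R i j ∧ q = x i j}

namespace IsSteinberg

variable {Q n : Type*} [Group Q] {x : n → n → Q}

theorem mem_rootSubgroup {R : n → n → Prop} {i j : n} (hij : i ≠ j) (h : R i j) :
    x i j ∈ rootSubgroup x R :=
  Subgroup.subset_closure ⟨i, j, hij, h, rfl⟩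

theorem rootSubgroup_le {R : n → n → Prop} {H : Subgroup Q}
    (h : ∀ i j, i ≠ j → R i j → x i j ∈ H) : rootSubgroup x R ≤ H := by
  refine (Subgroup.closure_le _).2 ?_
  rintro _ ⟨i, j, hij, hR, rfl⟩
  exact h i j hij hR

theorem rootSubgroup_le_normalizer (hx : IsSteinberg x) {R S : n → n → Prop}
    (hRS : ∀ i j k, R i j → S j k → S i k) (hSR : ∀ i j k, S i j → R j k → S i k)
    (hopp : ∀ i j, R i j → ¬ S j i) :
    rootSubgroup x R ≤ Subgroup.normalizer (rootSubgroup x S : Set Q) := by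
  refine closure_le_normalizer_closure ?_
  rintro _ ⟨i, j, hij, hR, rfl⟩ _ ⟨k, l, hkl, hS, rfl⟩
  change _ ∈ rootSubgroup x S ∧ _ ∈ rootSubgroup x S
  have hmem := mem_rootSubgroup (x := x) hkl hS
  by_cases hjk : j = k
  · subst hjk
    have hil : i ≠ l := by rintro rfl; exact hopp _ _ hR hS
    have hmem' := mem_rootSubgroup (x := x) hil (hRS _ _ _ hR hS)
    have hr := hx.rel i j l hij hkl hil
    have hc := (hx.commute i j i l hij hil hij.symm hil).eq
    have h1 : (x i j)⁻¹ * x j l * x i j = x i l * x j l := by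
      rw [mul_assoc, hr]; group
    have h2 : x i j * x j l * (x i j)⁻¹ = (x i l)⁻¹ * x j l := by
      rw [mul_inv_eq_iff_eq_mul, eq_comm, mul_assoc, inv_mul_eq_iff_eq_mul, hr, hc, mul_assoc]
    rw [h1, h2]
    exact ⟨mul_mem (inv_mem hmem') hmem, mul_mem hmem' hmem⟩
  by_cases hil : i = l
  · subst hil
    have hkj : k ≠ j := fun h => hjk h.symm
    have hmem' := mem_rootSubgroup (x := x) hkj (hSR _ _ _ hS hR)
    have hr := hx.rel k i j hkl hij hkj
    have hc := (hx.commute i j k j hij hkj hjk hij).eq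
    have h1 : x i j * x k i * (x i j)⁻¹ = x k i * x k j := by
      rw [hr]; group
    have h2 : (x i j)⁻¹ * x k i * x i j = x k i * (x k j)⁻¹ := by
      rw [mul_assoc, inv_mul_eq_iff_eq_mul, ← mul_assoc, eq_mul_inv_iff_mul_eq, hr, mul_assoc,
        hc, mul_assoc]
    rw [h1, h2]
    exact ⟨mul_mem hmem hmem', mul_mem hmem (inv_mem hmem')⟩
  · have hc := hx.commute i j k l hij hkl hjk hil
    rw [hc.eq, mul_inv_cancel_right, mul_assoc, hc.symm.eq, inv_mul_cancel_left]
    exact ⟨hmem, hmem⟩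

theorem rel_mem (hx : IsSteinberg x) {H : Subgroup Q} {i j k : n} (hij : i ≠ j) (hjk : j ≠ k)
    (hik : i ≠ k) (h₁ : x i j ∈ H) (h₂ : x j k ∈ H) : x i k ∈ H := by
  have h : x i k = (x i j)⁻¹ * (x j k * x i j) * (x j k)⁻¹ := by
    rw [hx.rel i j k hij hjk hik]; group
  rw [h]
  exact mul_mem (mul_mem (inv_mem h₁) (mul_mem h₂ h₁)) (inv_mem h₂)

variable {T : Subgroup Q}

theorem finite_rootSubgroup_col (hx : IsSteinberg x) (hT : IsLatticeLike T)
    (ht : ∀ i j, i ≠ j → IsOfFinOrder (x i j)) (p : n) :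
    Finite (rootSubgroup x fun _ j => j = p) := by
  refine hT.finite_closure_of_commute ?_ ?_
  · rintro _ ⟨i, j, hij, -, rfl⟩
    exact ht i j hij
  · rintro _ ⟨i, _, hij, rfl, rfl⟩ _ ⟨k, _, hkl, rfl, rfl⟩
    exact hx.commute _ _ _ _ hij hkl hkl.symm hij

theorem finite_rootSubgroup_row (hx : IsSteinberg x) (hT : IsLatticeLike T)
    (ht : ∀ i j, i ≠ j → IsOfFinOrder (x i j)) (p : n) :
    Finite (rootSubgroup x fun i _ => i = p) := by
  refine hT.finite_closure_of_commute ?_ ?_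
  · rintro _ ⟨i, j, hij, -, rfl⟩
    exact ht i j hij
  · rintro _ ⟨_, j, hij, rfl, rfl⟩ _ ⟨_, l, hkl, rfl, rfl⟩
    exact hx.commute _ _ _ _ hij hkl hij.symm hkl

theorem levi_le_normalizer_col (hx : IsSteinberg x) (p : n) :
    (rootSubgroup x fun i j => i ≠ p ∧ j ≠ p) ≤
      Subgroup.normalizer (rootSubgroup x (fun _ j => j = p) : Set Q) :=
  hx.rootSubgroup_le_normalizer (fun _ _ _ _ h => h) (fun _ _ _ h h' => (h'.1 h).elim)
    fun _ _ h h' => h.1 h'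

theorem levi_le_normalizer_row (hx : IsSteinberg x) (p : n) :
    (rootSubgroup x fun i j => i ≠ p ∧ j ≠ p) ≤
      Subgroup.normalizer (rootSubgroup x (fun i _ => i = p) : Set Q) :=
  hx.rootSubgroup_le_normalizer (fun _ _ _ h h' => (h.2 h').elim) (fun _ _ _ h _ => h)
    fun _ _ h h' => h.2 h'

theorem finite_levi (hx : IsSteinberg x) (hT : IsLatticeLike T)
    (ht : ∀ i j, i ≠ j → IsOfFinOrder (x i j)) (p : n) :
    Finite (rootSubgroup x fun i j => i ≠ p ∧ j ≠ p) := by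
  refine hT.finite_closure_of_normalizes ?_ (hx.finite_rootSubgroup_col hT ht p)
    (hx.finite_rootSubgroup_row hT ht p) (hx.levi_le_normalizer_col p)
    (hx.levi_le_normalizer_row p) ?_
  · rintro _ ⟨i, j, hij, -, rfl⟩
    exact ht i j hij
  · refine rootSubgroup_le fun i j hij h => ?_
    exact hx.rel_mem h.1 h.2.symm hij
      ((le_sup_left : _ ≤ _ ⊔ rootSubgroup x fun i _ => i = p) (mem_rootSubgroup h.1 rfl))
      ((le_sup_right : _ ≤ (rootSubgroup x fun _ j => j = p) ⊔ _) (mem_rootSubgroup h.2.symm rfl))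

theorem rootSubgroup_or (R S : n → n → Prop) :
    (rootSubgroup x fun i j => R i j ∨ S i j) = rootSubgroup x R ⊔ rootSubgroup x S := by
  apply le_antisymm
  · refine rootSubgroup_le fun i j hij h => ?_
    rcases h with h | h
    · exact (le_sup_left : _ ≤ _ ⊔ rootSubgroup x S) (mem_rootSubgroup hij h)
    · exact (le_sup_right : _ ≤ rootSubgroup x R ⊔ _) (mem_rootSubgroup hij h)
  · exact sup_le (rootSubgroup_le fun i j hij h => mem_rootSubgroup hij (Or.inl h))
      (rootSubgroup_le fun i j hij h => mem_rootSubgroup hij (Or.inr h))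

theorem rootSubgroup_congr {R S : n → n → Prop} (h : ∀ i j, i ≠ j → (R i j ↔ S i j)) :
    rootSubgroup x R = rootSubgroup x S :=
  le_antisymm (rootSubgroup_le fun i j hij hR => mem_rootSubgroup hij ((h i j hij).1 hR))
    (rootSubgroup_le fun i j hij hR => mem_rootSubgroup hij ((h i j hij).2 hR))

/-- A group generated by torsion Steinberg generators of rank at least two is finite as soon as
it is virtually torsion-free abelian. -/
theorem finite_closure (hx : IsSteinberg x) (hT : IsLatticeLike T)
    (ht : ∀ i j, i ≠ j → IsOfFinOrder (x i j)) {a b c : n} (hab : a ≠ b) (hca : c ≠ a)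
    (hcb : c ≠ b) : Finite (rootSubgroup x fun _ _ => True) := by
  set U := rootSubgroup x fun i j => j ≠ a ∧ i ≠ b
  set U' := rootSubgroup x fun i j => i ≠ a ∧ j ≠ b
  have hcoe : ∀ {R S V : n → n → Prop}, (∀ i j, i ≠ j → (V i j ↔ R i j ∨ S i j)) →
      rootSubgroup x R ≤ Subgroup.normalizer (rootSubgroup x S : Set Q) →
      (rootSubgroup x V : Set Q) = rootSubgroup x R * rootSubgroup x S := by
    intro R S V h hn
    rw [rootSubgroup_congr h, rootSubgroup_or, Subgroup.coe_mul_of_left_le_normalizer_right _ _ hn]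
  have hlevi : ∀ {R S : n → n → Prop} {p : n},
      (∀ i j, i ≠ j → (i ≠ p ∧ j ≠ p ↔ R i j ∨ S i j)) →
      rootSubgroup x R ⊔ rootSubgroup x S = rootSubgroup x fun i j => i ≠ p ∧ j ≠ p := by
    intro R S p h
    rw [rootSubgroup_congr h, rootSubgroup_or]
  have hLb := hlevi (p := b) (R := fun i j => (i ≠ b ∧ j ≠ b) ∧ j ≠ a)
    (S := fun i j => (i ≠ b ∧ j ≠ b) ∧ i ≠ a) (by grind)
  have hLa := hlevi (p := a) (R := fun i j => (i ≠ a ∧ j ≠ a) ∧ i ≠ b)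
    (S := fun i j => (i ≠ a ∧ j ≠ a) ∧ j ≠ b) (by grind)
  have hUb : (U : Set Q) = (rootSubgroup x fun i j => (i ≠ b ∧ j ≠ b) ∧ j ≠ a) *
      (rootSubgroup x fun _ j => j = b) :=
    hcoe (by grind) (le_trans (le_trans le_sup_left hLb.le) (hx.levi_le_normalizer_col b))
  have hUb' : (U' : Set Q) = (rootSubgroup x fun i j => (i ≠ b ∧ j ≠ b) ∧ i ≠ a) *
      (rootSubgroup x fun i _ => i = b) :=
    hcoe (by grind) (le_trans (le_trans le_sup_right hLb.le) (hx.levi_le_normalizer_row b))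
  have hUa : (U : Set Q) = (rootSubgroup x fun i j => (i ≠ a ∧ j ≠ a) ∧ i ≠ b) *
      (rootSubgroup x fun i _ => i = a) :=
    hcoe (by grind) (le_trans (le_trans le_sup_left hLa.le) (hx.levi_le_normalizer_row a))
  have hUa' : (U' : Set Q) = (rootSubgroup x fun i j => (i ≠ a ∧ j ≠ a) ∧ j ≠ b) *
      (rootSubgroup x fun _ j => j = a) :=
    hcoe (by grind) (le_trans (le_trans le_sup_right hLa.le) (hx.levi_le_normalizer_col a))
  have hfb := hx.finite_levi hT ht b
  have hfa := hx.finite_levi hT ht a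
  obtain ⟨N₁, h₁⟩ := coe_mul_coe_pow_mul_sup hUb hUb' (hLb ▸ hx.levi_le_normalizer_col b)
    (hLb ▸ hx.levi_le_normalizer_row b) (hLb ▸ hfb)
  obtain ⟨N₂, h₂⟩ := coe_mul_coe_pow_mul_sup hUa hUa' (hLa ▸ hx.levi_le_normalizer_row a)
    (hLa ▸ hx.levi_le_normalizer_col a) (hLa ▸ hfa)
  have h₁' := h₁ (max N₁ N₂) (le_max_left _ _)
  have h₂' := h₂ (max N₁ N₂) (le_max_right _ _)
  rw [hLb] at h₁'
  rw [hLa] at h₂'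
  set Y := ((U : Set Q) * (U' : Set Q)) ^ max N₁ N₂ with hY
  have hfinA : ∀ {A L : Subgroup Q}, A ≤ L → Finite L → (A : Set Q).Finite :=
    fun hAL hL => Set.Finite.subset (Set.toFinite (_ : Set Q)) hAL
  have hUfin : (U : Set Q).Finite := by
    rw [hUb]
    have := hx.finite_rootSubgroup_col hT ht b
    exact (hfinA (le_trans le_sup_left hLb.le) hfb).mul (Set.toFinite _)
  have hUfin' : (U' : Set Q).Finite := by
    rw [hUb']
    have := hx.finite_rootSubgroup_row hT ht b
    exact (hfinA (le_trans le_sup_right hLb.le) hfb).mul (Set.toFinite _)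
  have hpow : ∀ N : ℕ, (((U : Set Q) * (U' : Set Q)) ^ N).Finite := by
    intro N
    induction N with
    | zero => simp
    | succ N ih => exact pow_succ ((U : Set Q) * (U' : Set Q)) N ▸ ih.mul (hUfin.mul hUfin')
  have hYfin : Y.Finite := hpow _
  have hYone : (1 : Q) ∈ Y := Set.one_mem_pow ⟨1, U.one_mem, 1, U'.one_mem, mul_one 1⟩
  let St : Subgroup Q :=
    { carrier := {q | Y * {q} = Y}
      one_mem' := by simp
      mul_mem' := by
        intro p q hp hq
        change Y * {p} = Y at hp
        change Y * {q} = Y at hq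
        change Y * {p * q} = Y
        rw [← Set.singleton_mul_singleton, ← mul_assoc, hp, hq]
      inv_mem' := by
        intro p hp
        change Y * {p} = Y at hp
        change Y * {p⁻¹} = Y
        conv_lhs => rw [← hp]
        rw [mul_assoc, Set.singleton_mul_singleton, mul_inv_cancel, Set.singleton_one, mul_one] }
  have hSt : ∀ {L : Subgroup Q}, Y * (L : Set Q) = Y → L ≤ St := by
    intro L hL q hq
    change Y * {q} = Y
    have hsub : ∀ r ∈ L, Y * {r} ⊆ Y := fun r hr =>
      (Set.mul_subset_mul_left (Set.singleton_subset_iff.2 hr)).trans hL.subset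
    refine Set.Subset.antisymm (hsub q hq) ?_
    have := Set.mul_subset_mul_right (t := {q}) (hsub q⁻¹ (inv_mem hq))
    rwa [mul_assoc, Set.singleton_mul_singleton, inv_mul_cancel, Set.singleton_one, mul_one] at this
  have hb := hSt h₁'
  have ha := hSt h₂'
  have hall : (rootSubgroup x fun _ _ => True) ≤ St := by
    refine rootSubgroup_le fun i j hij _ => ?_
    by_cases h1 : i ≠ b ∧ j ≠ b
    · exact hb (mem_rootSubgroup hij h1)
    by_cases h2 : i ≠ a ∧ j ≠ a
    · exact ha (mem_rootSubgroup hij h2)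
    have hci : c ≠ i := by grind
    have hcj : c ≠ j := by grind
    have hmem : ∀ {i j : n}, i ≠ j → (i ≠ b ∧ j ≠ b) ∨ (i ≠ a ∧ j ≠ a) → x i j ∈ St := by
      rintro i j hij (h | h)
      · exact hb (mem_rootSubgroup hij h)
      · exact ha (mem_rootSubgroup hij h)
    exact hx.rel_mem hci.symm hcj hij (hmem hci.symm (by grind)) (hmem hcj (by grind))
  refine Set.Finite.subset hYfin fun q hq => ?_
  have h : Y * {q} = Y := hall hq
  rw [← h]
  exact ⟨1, hYone, q, rfl, one_mul q⟩

end IsSteinberg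

end Pointwise

section NielsenReduction

open FreeGroup

section CommonPrefix

variable {α : Type*} [DecidableEq α]

/-- The length of the longest common prefix of two lists. -/
def commonPrefix : List α → List α → ℕ
  | a :: l, b :: m => if a = b then commonPrefix l m + 1 else 0
  | _, _ => 0

theorem le_commonPrefix_iff {k : ℕ} {l m : List α} :
    k ≤ commonPrefix l m ↔ k ≤ l.length ∧ k ≤ m.length ∧ l.take k = m.take k := by
  induction l generalizing m k with
  | nil => simp +contextual [commonPrefix]
  | cons a l ih =>
    cases m with
    | nil => simp +contextual [commonPrefix]
    | cons b m =>
      cases k with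
      | zero => simp
      | succ k =>
        by_cases h : a = b
        · simp [commonPrefix, h, ih]
        · simp [commonPrefix, h]

theorem commonPrefix_comm (l m : List α) : commonPrefix l m = commonPrefix m l :=
  eq_of_forall_le_iff fun k => by simp only [le_commonPrefix_iff]; tauto

theorem commonPrefix_eq_of_lt {l m n : List α} (h : commonPrefix l m < commonPrefix m n) :
    commonPrefix l n = commonPrefix l m := by
  obtain ⟨hm, hn, -⟩ := le_commonPrefix_iff.1 (le_refl (commonPrefix m n))
  have take_eq : ∀ k ≤ commonPrefix m n, m.take k = n.take k := fun k hk =>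
    (le_commonPrefix_iff.1 hk).2.2
  obtain ⟨h1, h2, h3⟩ := le_commonPrefix_iff.1 (le_refl (commonPrefix l m))
  apply le_antisymm
  · by_contra! hlt
    have h4 : commonPrefix l m + 1 ≤ commonPrefix l n := hlt
    obtain ⟨h5, h6, h7⟩ := le_commonPrefix_iff.1 h4
    have : commonPrefix l m + 1 ≤ commonPrefix l m :=
      le_commonPrefix_iff.2 ⟨h5, by omega, h7.trans (take_eq _ h).symm⟩
    omega
  · exact le_commonPrefix_iff.2 ⟨h1, by omega, h3.trans (take_eq _ h.le)⟩

theorem ne_of_mem_head?_drop_commonPrefix (l m : List α) {a b : α}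
    (ha : a ∈ (l.drop (commonPrefix l m)).head?) (hb : b ∈ (m.drop (commonPrefix l m)).head?) :
    a ≠ b := by
  induction l generalizing m with
  | nil => simp at ha
  | cons c l ih =>
    cases m with
    | nil => simp at hb
    | cons d m =>
      by_cases h : c = d
      · simp only [commonPrefix, h, if_true, List.drop_succ_cons] at ha hb
        exact ih m ha hb
      · simp only [commonPrefix, h, if_false, List.drop_zero, List.head?_cons, Option.mem_def,
          Option.some.injEq] at ha hb
        subst ha hb
        exact h

end CommonPrefix

section Cancellation

variable {S : Type*} [DecidableEq S]

theorem isReduced_invRev {w : List (S × Bool)} (h : IsReduced w) : IsReduced (invRev w) := by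
  rw [isReduced_iff_reduce_eq] at h ⊢
  rw [reduce_invRev, h]

theorem toWord_inv_mul_eq (g h : FreeGroup S) :
    (g⁻¹ * h).toWord = invRev (g.toWord.drop (commonPrefix g.toWord h.toWord)) ++
      h.toWord.drop (commonPrefix g.toWord h.toWord) := by
  set k := commonPrefix g.toWord h.toWord with hk
  obtain ⟨-, -, htake⟩ := le_commonPrefix_iff.1 hk.le
  have hred : IsReduced (invRev (g.toWord.drop k) ++ h.toWord.drop k) := by
    refine List.isChain_append.2 ⟨isReduced_invRev (List.IsChain.drop isReduced_toWord k),
      List.IsChain.drop isReduced_toWord k, ?_⟩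
    intro x hx y hy hxy
    rw [invRev, List.getLast?_reverse, List.head?_map, Option.mem_def,
      Option.map_eq_some_iff] at hx
    obtain ⟨a, ha, rfl⟩ := hx
    have hne := ne_of_mem_head?_drop_commonPrefix _ _ ha hy
    by_contra hb
    exact hne (Prod.ext hxy (by simpa using hb))
  rw [← hred.reduce_eq, ← toWord_mk]
  congr 1
  have hg : g = FreeGroup.mk (g.toWord.take k) * FreeGroup.mk (g.toWord.drop k) := by
    rw [mul_mk, List.take_append_drop, mk_toWord]
  have hh : h = FreeGroup.mk (g.toWord.take k) * FreeGroup.mk (h.toWord.drop k) := by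
    rw [htake, mul_mk, List.take_append_drop, mk_toWord]
  rw [← mul_mk, ← inv_mk]
  conv_lhs => rw [hg, hh]
  group

/-- The number of letters cancelled in the product `g⁻¹ * h`. -/
def gromov (g h : FreeGroup S) : ℕ := commonPrefix g.toWord h.toWord

theorem gromov_comm (g h : FreeGroup S) : gromov g h = gromov h g := commonPrefix_comm _ _

theorem gromov_le_norm_left (g h : FreeGroup S) : gromov g h ≤ g.norm :=
  (le_commonPrefix_iff.1 (le_refl (gromov g h))).1

theorem gromov_le_norm_right (g h : FreeGroup S) : gromov g h ≤ h.norm :=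
  (le_commonPrefix_iff.1 (le_refl (gromov g h))).2.1

theorem norm_inv_mul_add (g h : FreeGroup S) :
    (g⁻¹ * h).norm + 2 * gromov g h = g.norm + h.norm := by
  have h1 := gromov_le_norm_left g h
  have h2 := gromov_le_norm_right g h
  unfold FreeGroup.norm at *
  rw [toWord_inv_mul_eq, List.length_append, invRev_length, List.length_drop, List.length_drop]
  unfold gromov at *
  omega

theorem norm_mul_add (g h : FreeGroup S) :
    (g * h).norm + 2 * gromov g⁻¹ h = g.norm + h.norm := by
  simpa using norm_inv_mul_add g⁻¹ h

theorem gromov_eq_of_lt {g h k : FreeGroup S} (hlt : gromov g h < gromov h k) :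
    gromov g k = gromov g h :=
  commonPrefix_eq_of_lt hlt

theorem two_mul_gromov_inv_self_lt {g : FreeGroup S} (hg : g ≠ 1) :
    2 * gromov g⁻¹ g < g.norm := by
  by_contra! hle
  set k := gromov g⁻¹ g with hk
  obtain ⟨h1, h2, h3⟩ := le_commonPrefix_iff.1 hk.le
  rw [toWord_inv] at h1 h3
  set w := g.toWord with hw
  have hn : w.length = g.norm := rfl
  have hpos : 0 < w.length := by
    rw [hn, Nat.pos_iff_ne_zero, Ne, FreeGroup.norm_eq_zero]
    exact hg
  have hget : ∀ m (hm : m < k), w[m]'(by omega) =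
      ((w[w.length - 1 - m]'(by omega)).1, !(w[w.length - 1 - m]'(by omega)).2) := by
    intro m hm
    have h4 : (w.take k)[m]? = ((invRev w).take k)[m]? := by rw [h3]
    rw [List.getElem?_take_of_lt hm, List.getElem?_take_of_lt hm, List.getElem?_eq_getElem (by omega),
      List.getElem?_eq_getElem (by rw [invRev_length]; omega), Option.some.injEq] at h4
    rw [h4]
    simp [invRev, List.getElem_reverse]
  rcases Nat.even_or_odd' w.length with ⟨m, hm | hm⟩
  · have h5 := hget (m - 1) (by omega)
    have h6 := List.isChain_iff_getElem.1 (isReduced_toWord (x := g)) (m - 1)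
      (by rw [← hw]; omega)
    have h7 : w.length - 1 - (m - 1) = m - 1 + 1 := by omega
    simp only [h7] at h5
    have h10 := congrArg Prod.fst h5
    have h8 := h6 h10
    have h9 := congrArg Prod.snd h5
    simp only [← hw] at h8
    rw [h8] at h9
    simp at h9
  · have h5 := hget m (by omega)
    have h7 : w.length - 1 - m = m := by omega
    simp only [h7] at h5
    have h9 := congrArg Prod.snd h5
    simp at h9

end Cancellation

section HalfValue

variable {S : Type*} [Fintype S]

/-- A numerical value of a word; among words of equal length it is injective. -/
noncomputable def wordValue (w : List (S × Bool)) : ℕ :=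
  Nat.ofDigits (Fintype.card (S × Bool) + 1) (w.map fun x => (Fintype.equivFin (S × Bool) x : ℕ))

theorem wordValue_append (w w' : List (S × Bool)) : wordValue (w ++ w') =
    wordValue w + (Fintype.card (S × Bool) + 1) ^ w.length * wordValue w' := by
  simp [wordValue, Nat.ofDigits_append]

theorem wordValue_append_le_iff {w p q : List (S × Bool)} :
    wordValue (w ++ p) ≤ wordValue (w ++ q) ↔ wordValue p ≤ wordValue q := by
  rw [wordValue_append, wordValue_append, Nat.add_le_add_iff_left]
  exact Nat.mul_le_mul_left_iff (by positivity)

theorem eq_of_wordValue_eq {p q : List (S × Bool)} (hlen : p.length = q.length)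
    (h : wordValue p = wordValue q) : p = q := by
  rcases isEmpty_or_nonempty S with hS | hS
  · have : ∀ l : List (S × Bool), l = [] := fun l => List.eq_nil_iff_forall_not_mem.2
      fun x => isEmptyElim x.1
    rw [this p, this q]
  have hcard : 1 < Fintype.card (S × Bool) + 1 := by
    have := Fintype.card_pos (α := S × Bool)
    omega
  have hlt : ∀ l : List (S × Bool), ∀ x ∈ l.map fun x => (Fintype.equivFin (S × Bool) x : ℕ),
      x < Fintype.card (S × Bool) + 1 := by
    intro l x hx
    obtain ⟨y, -, rfl⟩ := List.mem_map.1 hx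
    exact (Fintype.equivFin (S × Bool) y).2.trans (Nat.lt_succ_self _)
  have := Nat.ofDigits_inj_of_len_eq hcard (by simpa using hlen) (hlt p) (hlt q) h
  refine List.map_injective_iff.2 ?_ this
  intro x y hxy
  exact (Fintype.equivFin (S × Bool)).injective (Fin.ext hxy)

variable [DecidableEq S]

/-- The tie-breaking quantity in Nielsen reduction: the values of the second halves of the words
of `g` and of `g⁻¹`. -/
noncomputable def halfValue (g : FreeGroup S) : ℕ :=
  wordValue (g.toWord.drop (g.norm / 2)) + wordValue (g⁻¹.toWord.drop (g.norm / 2))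

theorem halfValue_inv (g : FreeGroup S) : halfValue g⁻¹ = halfValue g := by
  rw [halfValue, halfValue, inv_inv, norm_inv_eq, add_comm]

theorem halfValue_append_le {g h : FreeGroup S} {w p q : List (S × Bool)}
    (hg : g.toWord = w ++ p) (hh : h.toWord = w ++ q) (hpq : p.length = q.length)
    (hp : p.length ≤ w.length) (hle : halfValue g ≤ halfValue h) :
    wordValue p ≤ wordValue q := by
  have hgn : g.norm = w.length + p.length := by rw [FreeGroup.norm, hg, List.length_append]
  have hhn : h.norm = w.length + p.length := by rw [FreeGroup.norm, hh, List.length_append, hpq]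
  have hdrop : ∀ r : List (S × Bool), r.length = q.length →
      (w ++ r).drop ((w.length + p.length) / 2) = w.drop ((w.length + p.length) / 2) ++ r ∧
      (invRev r ++ invRev w).drop ((w.length + p.length) / 2) =
        (invRev w).drop ((w.length + p.length) / 2 - q.length) := by
    intro r hr
    refine ⟨List.drop_append_of_le_length (by omega), ?_⟩
    rw [List.drop_append, List.drop_eq_nil_of_le (by rw [invRev_length]; omega), invRev_length, hr,
      List.nil_append]
  rw [halfValue, halfValue, toWord_inv, toWord_inv, hg, hh, hgn, hhn, invRev_append,
    invRev_append, (hdrop p hpq).1, (hdrop p hpq).2, (hdrop q rfl).1, (hdrop q rfl).2,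
    Nat.add_le_add_iff_right, wordValue_append_le_iff] at hle
  exact hle

theorem wordValue_le_of_halfValue_le {a b : FreeGroup S} (hb : 2 * gromov a⁻¹ b = b.norm)
    (ha : 2 * gromov a⁻¹ b ≤ a.norm) (hle : halfValue a ≤ halfValue (a * b)) :
    wordValue (invRev (b.toWord.take (gromov a⁻¹ b))) ≤
      wordValue (b.toWord.drop (gromov a⁻¹ b)) := by
  set k := gromov a⁻¹ b with hk
  obtain ⟨h1, h2, h3⟩ := le_commonPrefix_iff.1 hk.le
  have hab := toWord_inv_mul_eq a⁻¹ b
  rw [inv_inv] at hab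
  change _ = invRev (a⁻¹.toWord.drop k) ++ b.toWord.drop k at hab
  have haw : a.toWord = invRev (a⁻¹.toWord.drop k) ++ invRev (b.toWord.take k) := by
    rw [← h3, ← invRev_append, List.take_append_drop, toWord_inv, invRev_invRev]
  have hna : a⁻¹.toWord.length = a.norm := by rw [toWord_inv, invRev_length]; rfl
  have hnb : b.toWord.length = b.norm := rfl
  refine halfValue_append_le haw hab ?_ ?_ hle
  · simp only [invRev_length, List.length_take, List.length_drop]
    omega
  · simp only [invRev_length, List.length_take, List.length_drop]
    omega

/-- Minimality of half-values excludes that an element cancels completely, one half on each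
side. -/
theorem gromov_add_gromov_ne {a b c : FreeGroup S} (hb : b ≠ 1)
    (hab : 2 * gromov a⁻¹ b = b.norm) (ha : b.norm ≤ a.norm) (hva : halfValue a ≤ halfValue (a * b))
    (hbc : 2 * gromov b⁻¹ c = b.norm) (hc : b.norm ≤ c.norm)
    (hvc : halfValue c ≤ halfValue (b * c)) : False := by
  have h1 := wordValue_le_of_halfValue_le hab (by omega) hva
  have hcomm : gromov (c⁻¹)⁻¹ b⁻¹ = gromov b⁻¹ c := by rw [inv_inv, gromov_comm]
  have h2 := wordValue_le_of_halfValue_le (a := c⁻¹) (b := b⁻¹)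
    (by rw [hcomm, norm_inv_eq, hbc]) (by rw [hcomm, norm_inv_eq]; omega)
    (by rw [halfValue_inv, ← mul_inv_rev, halfValue_inv]; exact hvc)
  rw [hcomm] at h2
  have hk : gromov b⁻¹ c = gromov a⁻¹ b := by omega
  rw [hk] at h2
  set k := gromov a⁻¹ b
  have hlen : b.toWord.length = 2 * k := hab.symm
  have hsplit : b⁻¹.toWord = invRev (b.toWord.drop k) ++ invRev (b.toWord.take k) := by
    rw [toWord_inv, ← invRev_append, List.take_append_drop]
  have hlen' : (invRev (b.toWord.drop k)).length = k := by
    rw [invRev_length, List.length_drop]; omega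
  rw [hsplit, List.take_left' hlen', List.drop_left' hlen', invRev_invRev] at h2
  have heq := eq_of_wordValue_eq
    (by simp only [invRev_length, List.length_take, List.length_drop]; omega) (le_antisymm h1 h2)
  apply hb
  rw [← mk_toWord (x := b), ← List.take_append_drop k b.toWord, ← mul_mk, ← heq, ← inv_mk,
    mul_inv_cancel]

end HalfValue

section Transvection

variable {S : Type*} [DecidableEq S]

/-- The endomorphism multiplying the generator `i` by `g`, on the left or on the right. -/
def transvHom (b : Bool) (i : S) (g : FreeGroup S) : FreeGroup S →* FreeGroup S :=
  lift fun k => if k = i then cond b (g * of k) (of k * g) else of k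

theorem transvHom_of_self (b : Bool) (i : S) (g : FreeGroup S) :
    transvHom b i g (of i) = cond b (g * of i) (of i * g) := by
  simp [transvHom]

theorem transvHom_of_ne {b : Bool} {i k : S} (h : k ≠ i) (g : FreeGroup S) :
    transvHom b i g (of k) = of k := by
  simp [transvHom, h]

theorem transvHom_comp_inv (b : Bool) {i : S} {g : FreeGroup S} (hg : transvHom b i g g = g) :
    (transvHom b i g).comp (transvHom b i g⁻¹) = MonoidHom.id _ := by
  ext k
  by_cases h : k = i
  · subst h
    cases b <;> simp [transvHom_of_self, hg]
  · simp [transvHom_of_ne h]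

/-- The left (`true`) or right (`false`) Nielsen transvection multiplying the generator `i` by
the generator `j`; it is the identity for `i = j`. -/
def transv (b : Bool) (i j : S) : MulAut (FreeGroup S) :=
  if h : j = i then 1 else
    MonoidHom.toMulEquiv (transvHom b i (of j)) (transvHom b i (of j)⁻¹)
      (by
        have := transvHom_comp_inv b (i := i) (g := (of j)⁻¹)
          (by rw [_root_.map_inv, transvHom_of_ne h])
        rwa [inv_inv] at this)
      (transvHom_comp_inv b (transvHom_of_ne h _))

theorem transv_of_self (b : Bool) {i j : S} (h : i ≠ j) :
    transv b i j (of i) = cond b (of j * of i) (of i * of j) := by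
  rw [transv, dif_neg h.symm]
  exact transvHom_of_self b i (of j)

theorem transv_of_ne (b : Bool) {i k : S} (h : k ≠ i) (j : S) :
    transv b i j (of k) = of k := by
  rw [transv]
  split_ifs
  · rfl
  · exact transvHom_of_ne h _

theorem transv_inv_of_self (b : Bool) {i j : S} (h : i ≠ j) :
    (transv b i j)⁻¹ (of i) = cond b ((of j)⁻¹ * of i) (of i * (of j)⁻¹) := by
  rw [transv, dif_neg h.symm]
  exact transvHom_of_self b i (of j)⁻¹

theorem transv_inv_of_ne (b : Bool) {i k : S} (h : k ≠ i) (j : S) :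
    (transv b i j)⁻¹ (of k) = of k := by
  rw [MulAut.inv_apply, MulEquiv.symm_apply_eq, transv_of_ne b h]

/-- The subgroup generated by the Nielsen transvections. -/
def transvSubgroup (S : Type*) [DecidableEq S] : Subgroup (MulAut (FreeGroup S)) :=
  Subgroup.closure {e | ∃ b i j, i ≠ j ∧ e = transv b i j}

theorem transv_mem (b : Bool) {i j : S} (h : i ≠ j) : transv b i j ∈ transvSubgroup S :=
  Subgroup.subset_closure ⟨b, i, j, h, rfl⟩

end Transvection

section Letter

variable {S : Type*} {G : Type*} [Group G]

/-- The element `y i` or `(y i)⁻¹` according to the sign. -/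
def letter (y : S → G) (s : S × Bool) : G := cond s.2 (y s.1) (y s.1)⁻¹

theorem map_letter {H : Type*} [Group H] (f : G →* H) (y : S → G) (s : S × Bool) :
    f (letter y s) = letter (fun i => f (y i)) s := by
  rcases s with ⟨i, b⟩
  cases b <;> simp [letter]

theorem letter_inv (y : S → G) (i : S) (b : Bool) : (letter y (i, b))⁻¹ = letter y (i, !b) := by
  cases b <;> simp [letter]

theorem exists_transv_letter [DecidableEq S] {s t : S × Bool} (h : s.1 ≠ t.1) :
    ∃ e ∈ transvSubgroup S, (∀ k ≠ s.1, e (of k) = of k) ∧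
      e (letter of s) = letter of s * letter of t := by
  obtain ⟨i, b⟩ := s
  obtain ⟨j, c⟩ := t
  change i ≠ j at h
  cases b <;> cases c
  · exact ⟨transv true i j, transv_mem _ h, fun k hk => transv_of_ne _ hk _,
      by simp [letter, transv_of_self _ h]⟩
  · exact ⟨(transv true i j)⁻¹, inv_mem (transv_mem _ h), fun k hk => transv_inv_of_ne _ hk _,
      by simp only [letter, cond_true, cond_false, _root_.map_inv, transv_inv_of_self _ h]; group⟩
  · exact ⟨(transv false i j)⁻¹, inv_mem (transv_mem _ h), fun k hk => transv_inv_of_ne _ hk _,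
      by simp only [letter, cond_true, cond_false, transv_inv_of_self _ h]⟩
  · exact ⟨transv false i j, transv_mem _ h, fun k hk => transv_of_ne _ hk _,
      by simp [letter, transv_of_self _ h]⟩

end Letter

section NielsenReduced

variable {S : Type*} [DecidableEq S]

theorem norm_letter (y : S → FreeGroup S) (s : S × Bool) : (letter y s).norm = (y s.1).norm := by
  rcases s with ⟨i, b⟩
  cases b <;> simp [letter]

variable [Fintype S]

theorem halfValue_letter (y : S → FreeGroup S) (s : S × Bool) :
    halfValue (letter y s) = halfValue (y s.1) := by
  rcases s with ⟨i, b⟩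
  cases b <;> simp [letter, halfValue_inv]

/-- A tuple which no elementary Nielsen transformation makes smaller. -/
structure IsNielsenReduced (y : S → FreeGroup S) : Prop where
  ne_one : ∀ i, y i ≠ 1
  le_mul : ∀ s t : S × Bool, s.1 ≠ t.1 →
    (letter y s).norm < (letter y s * letter y t).norm ∨
      (letter y s).norm = (letter y s * letter y t).norm ∧
        halfValue (letter y s) ≤ halfValue (letter y s * letter y t)

namespace IsNielsenReduced

variable {y : S → FreeGroup S}

theorem letter_ne_one (hy : IsNielsenReduced y) (s : S × Bool) : letter y s ≠ 1 := by
  rcases s with ⟨i, b⟩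
  cases b <;> simp [letter, hy.ne_one]

theorem letter_le_mul_left (hy : IsNielsenReduced y) (s t : S × Bool) (h : s.1 ≠ t.1) :
    (letter y t).norm < (letter y s * letter y t).norm ∨
      (letter y t).norm = (letter y s * letter y t).norm ∧
        halfValue (letter y t) ≤ halfValue (letter y s * letter y t) := by
  obtain ⟨i, b⟩ := s
  obtain ⟨j, c⟩ := t
  have := hy.le_mul (j, !c) (i, !b) h.symm
  rwa [← letter_inv, ← letter_inv, ← mul_inv_rev, norm_inv_eq, norm_inv_eq, halfValue_inv,
    halfValue_inv] at this

theorem two_mul_gromov_le (hy : IsNielsenReduced y) {s t : S × Bool} (h : s.1 = t.1 → s.2 = t.2) :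
    2 * gromov (letter y s)⁻¹ (letter y t) ≤ (letter y s).norm ∧
      2 * gromov (letter y s)⁻¹ (letter y t) ≤ (letter y t).norm := by
  by_cases hst : s.1 = t.1
  · obtain rfl : s = t := Prod.ext hst (h hst)
    have := two_mul_gromov_inv_self_lt (hy.letter_ne_one s)
    omega
  · have h1 := norm_mul_add (letter y s) (letter y t)
    have h2 := hy.le_mul s t hst
    have h3 := hy.letter_le_mul_left s t hst
    omega

theorem gromov_add_gromov_lt (hy : IsNielsenReduced y) {r s t : S × Bool}
    (hrs : r.1 = s.1 → r.2 = s.2) (hst : s.1 = t.1 → s.2 = t.2) :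
    gromov (letter y r)⁻¹ (letter y s) + gromov (letter y s)⁻¹ (letter y t) <
      (letter y s).norm := by
  have h1 := hy.two_mul_gromov_le hrs
  have h2 := hy.two_mul_gromov_le hst
  by_contra! hle
  have hne := hy.letter_ne_one s
  have hrs' : r.1 ≠ s.1 := by
    intro h
    obtain rfl : r = s := Prod.ext h (hrs h)
    have := two_mul_gromov_inv_self_lt hne
    omega
  have hst' : s.1 ≠ t.1 := by
    intro h
    obtain rfl : s = t := Prod.ext h (hst h)
    have := two_mul_gromov_inv_self_lt hne
    omega
  have h3 := norm_mul_add (letter y r) (letter y s)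
  have h4 := norm_mul_add (letter y s) (letter y t)
  have h5 := hy.le_mul r s hrs'
  have h6 := hy.letter_le_mul_left s t hst'
  exact gromov_add_gromov_ne hne (a := letter y r) (c := letter y t) (by omega) (by omega)
    (by omega) (by omega) (by omega) (by omega)

theorem gromov_prod (hy : IsNielsenReduced y) (t : S × Bool) (L : List (S × Bool))
    (hL : IsReduced (t :: L)) (s : S × Bool) (hst : s.1 = t.1 → s.2 = t.2) :
    gromov (letter y s)⁻¹ (((t :: L).map (letter y)).prod) = gromov (letter y s)⁻¹ (letter y t) ∧
      gromov (letter y s)⁻¹ (letter y t) + (t :: L).length ≤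
        (((t :: L).map (letter y)).prod).norm := by
  induction L generalizing t s with
  | nil =>
    have h1 := hy.two_mul_gromov_le hst
    have h2 : (letter y t).norm ≠ 0 := by
      rw [Ne, FreeGroup.norm_eq_zero]
      exact hy.letter_ne_one t
    simp only [List.map_cons, List.map_nil, List.prod_cons, List.prod_nil, mul_one, List.length_cons,
      List.length_nil, true_and]
    omega
  | cons r L ih =>
    rw [isReduced_cons_cons] at hL
    obtain ⟨h1, h2⟩ := ih r hL.2 t hL.1
    have h3 := hy.gromov_add_gromov_lt hst hL.1
    rw [List.map_cons, List.prod_cons, List.length_cons]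
    set g := ((r :: L).map (letter y)).prod
    have h4 := norm_mul_add (letter y t) g
    have h5 := norm_inv_mul_add (letter y t) (letter y t * g)
    rw [inv_mul_cancel_left] at h5
    have h6 : gromov (letter y s)⁻¹ (letter y t * g) = gromov (letter y s)⁻¹ (letter y t) :=
      gromov_eq_of_lt (by omega)
    refine ⟨h6, ?_⟩
    omega

theorem norm_le_norm_lift (hy : IsNielsenReduced y) (w : FreeGroup S) :
    w.norm ≤ (lift y w).norm := by
  have hw : lift y w = (w.toWord.map (letter y)).prod := by
    conv_lhs => rw [← mk_toWord (x := w), lift_mk]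
    rfl
  have hred : IsReduced w.toWord := isReduced_toWord
  rw [hw]
  change w.toWord.length ≤ _
  cases hL : w.toWord with
  | nil => simp
  | cons t L =>
    rw [hL] at hred
    exact le_trans (Nat.le_add_left _ _) (hy.gromov_prod t L hred t fun _ => rfl).2

end IsNielsenReduced

/-- The automorphisms of a free group sending generators to generators or their inverses. -/
def signedPerms (S : Type*) : Set (MulAut (FreeGroup S)) :=
  {β | ∀ i, ∃ s : S × Bool, β (of i) = letter of s}

theorem finite_signedPerms (S : Type*) [Finite S] : (signedPerms S).Finite := by
  choose f hf using fun β : signedPerms S => β.2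
  refine Set.finite_coe_iff.1 (Finite.of_injective f fun β γ h => ?_)
  apply Subtype.ext
  apply MulEquiv.toMonoidHom_injective
  ext i
  exact (hf β i).trans ((congrArg _ (congrFun h i)).trans (hf γ i).symm)

theorem exists_isNielsenReduced (α : MulAut (FreeGroup S)) :
    ∃ h ∈ transvSubgroup S, IsNielsenReduced fun i => (α * h) (of i) := by
  let μ : transvSubgroup S → ℕ ×ₗ ℕ := fun h =>
    toLex (∑ i, ((α * h) (of i)).norm, ∑ i, halfValue ((α * h) (of i)))
  obtain ⟨⟨h, hh⟩, hmin⟩ : ∃ h, ∀ h', μ h ≤ μ h' := by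
    obtain ⟨_, ⟨h, rfl⟩, hh⟩ := WellFounded.has_min (wellFounded_lt (α := ℕ ×ₗ ℕ)) (Set.range μ)
      ⟨_, 1, rfl⟩
    exact ⟨h, fun h' => not_lt.1 (hh _ ⟨h', rfl⟩)⟩
  refine ⟨h, hh, fun i => ?_, fun s t hst => ?_⟩
  · rw [Ne, EmbeddingLike.map_eq_one_iff]
    exact of_ne_one i
  obtain ⟨e, he, hek, hes⟩ := exists_transv_letter hst
  have hle := hmin ⟨h * e, mul_mem hh he⟩
  set y : S → FreeGroup S := fun i => (α * h) (of i) with hy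
  set z : S → FreeGroup S := fun i => (α * (h * e)) (of i) with hz
  have hzk : ∀ k ≠ s.1, z k = y k := fun k hk => by
    simp only [hz, hy, MulAut.mul_apply, hek k hk]
  have hzs : letter z s = letter y s * letter y t := by
    have := congrArg (α * h) hes
    rw [_root_.map_mul] at this
    have h1 := map_letter (α * h : MulAut (FreeGroup S)).toMonoidHom of
    have h2 := map_letter (α * (h * e) : MulAut (FreeGroup S)).toMonoidHom of s
    exact (h2.symm.trans this).trans (congrArg₂ (· * ·) (h1 s) (h1 t))
  have hsum : ∀ f : FreeGroup S → ℕ, ∃ c, ∑ i, f (y i) = f (y s.1) + c ∧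
      ∑ i, f (z i) = f (z s.1) + c := by
    intro f
    refine ⟨∑ i ∈ Finset.univ.erase s.1, f (y i),
      (Finset.add_sum_erase _ _ (Finset.mem_univ _)).symm, ?_⟩
    rw [← Finset.add_sum_erase _ _ (Finset.mem_univ s.1)]
    congr 1
    exact Finset.sum_congr rfl fun k hk => by rw [hzk k (Finset.ne_of_mem_erase hk)]
  obtain ⟨c, hc1, hc2⟩ := hsum FreeGroup.norm
  obtain ⟨d, hd1, hd2⟩ := hsum halfValue
  rw [← hzs, norm_letter, norm_letter, halfValue_letter, halfValue_letter]
  change toLex (∑ i, (y i).norm, ∑ i, halfValue (y i)) ≤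
    toLex (∑ i, (z i).norm, ∑ i, halfValue (z i)) at hle
  rw [hc1, hc2, hd1, hd2, Prod.Lex.toLex_le_toLex] at hle
  simp only at hle
  omega

/-- Nielsen's theorem: up to signed permutations of the generators, automorphisms of a free group
of finite rank are products of transvections. -/
theorem exists_mul_inv_mem_signedPerms (α : MulAut (FreeGroup S)) :
    ∃ h ∈ transvSubgroup S, (α * h)⁻¹ ∈ signedPerms S := by
  obtain ⟨h, hh, hred⟩ := exists_isNielsenReduced α
  refine ⟨h, hh, fun i => ?_⟩
  set w := (α * h)⁻¹ (of i) with hw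
  have hlift : lift (fun i => (α * h) (of i)) w = of i := by
    have : lift (fun i => (α * h) (of i)) = (α * h : MulAut (FreeGroup S)).toMonoidHom := by
      ext; simp
    rw [this, hw]
    exact (α * h).apply_symm_apply _
  have hle := hred.norm_le_norm_lift w
  rw [hlift, norm_of] at hle
  have hne : w ≠ 1 := by
    rw [hw, Ne, EmbeddingLike.map_eq_one_iff]
    exact of_ne_one i
  have hlen : w.toWord.length = 1 := by
    have := FreeGroup.norm_eq_zero.not.2 hne
    change w.norm = 1
    omega
  obtain ⟨s, hs⟩ := List.length_eq_one_iff.1 hlen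
  refine ⟨s, ?_⟩
  rw [← mk_toWord (x := w), hs]
  obtain ⟨j, b⟩ := s
  cases b <;> simp [letter, of, inv_mk, invRev]

end NielsenReduced

end NielsenReduction

/-- The group `GL_C(ℤ)`. -/
abbrev LinAut (C : Type*) := (C → ℤ) ≃ₗ[ℤ] (C → ℤ)

section Elementary

variable {C : Type*} [DecidableEq C]

/-- The elementary automorphism of `C → ℤ` adding the `i`-th coordinate to the `j`-th; it is the
identity for `i = j`. -/
def elemAut (i j : C) : LinAut C :=
  if h : i = j then 1 else
    { toFun := fun v => v + Pi.single j (v i)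
      invFun := fun v => v - Pi.single j (v i)
      left_inv := fun v => by simp [h]
      right_inv := fun v => by simp [h]
      map_add' := fun v w => by
        rw [Pi.add_apply, Pi.single_add]
        abel
      map_smul' := fun c v => by
        rw [Pi.smul_apply, Pi.single_smul, smul_add, RingHom.id_apply] }

theorem elemAut_apply {i j : C} (h : i ≠ j) (v : C → ℤ) :
    elemAut i j v = v + Pi.single j (v i) := by
  rw [elemAut, dif_neg h]
  rfl

theorem elemAut_inv_apply {i j : C} (h : i ≠ j) (v : C → ℤ) :
    (elemAut i j)⁻¹ v = v - Pi.single j (v i) := by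
  rw [elemAut, dif_neg h]
  rfl

theorem isSteinberg_elemAut : IsSteinberg (elemAut (C := C)) where
  commute i j k l hij hkl hjk hil := by
    refine LinearEquiv.ext fun v => ?_
    simp only [LinearEquiv.mul_apply, elemAut_apply hij, elemAut_apply hkl, Pi.add_apply,
      Pi.single_eq_of_ne hil, Pi.single_eq_of_ne hjk.symm, add_zero]
    abel
  rel i j k hij hjk hik := by
    refine LinearEquiv.ext fun v => ?_
    simp only [LinearEquiv.mul_apply, elemAut_apply hij, elemAut_apply hjk, elemAut_apply hik,
      Pi.add_apply, Pi.single_eq_same, Pi.single_add, Pi.single_eq_of_ne hik, add_zero]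
    abel

/-- The group generated by the elementary automorphisms not involving coordinates in `D`. -/
def elemSubgroup (D : Finset C) : Subgroup (LinAut C) :=
  rootSubgroup elemAut fun i j => i ∉ D ∧ j ∉ D

theorem elemAut_mem {D : Finset C} {i j : C} (h : i ≠ j) (hi : i ∉ D) (hj : j ∉ D) :
    elemAut i j ∈ elemSubgroup D :=
  IsSteinberg.mem_rootSubgroup h ⟨hi, hj⟩

theorem elemSubgroup_le (D : Finset C) :
    elemSubgroup D ≤ rootSubgroup (elemAut (C := C)) fun _ _ => True :=
  IsSteinberg.rootSubgroup_le fun _ _ h _ => IsSteinberg.mem_rootSubgroup h trivial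

theorem apply_of_mem_elemSubgroup {D : Finset C} {h : LinAut C} (hh : h ∈ elemSubgroup D) :
    ∀ i ∈ D, (∀ v, h v i = v i) ∧ ∀ c, h (Pi.single i c) = Pi.single i c := by
  intro i hi
  induction hh using Subgroup.closure_induction with
  | mem x hx =>
    obtain ⟨j, k, hjk, ⟨hj, hk⟩, rfl⟩ := hx
    have hij : i ≠ j := by rintro rfl; exact hj hi
    have hik : i ≠ k := by rintro rfl; exact hk hi
    exact ⟨fun v => by simp [elemAut_apply hjk, hik],
      fun c => by simp [elemAut_apply hjk, hij.symm]⟩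
  | one => exact ⟨fun _ => rfl, fun _ => rfl⟩
  | mul x y _ _ ihx ihy =>
    exact ⟨fun v => (ihx.1 _).trans (ihy.1 v), fun c => by rw [LinearEquiv.mul_apply, ihy.2, ihx.2]⟩
  | inv x _ ih =>
    refine ⟨fun v => ?_, fun c => ?_⟩
    · rw [← ih.1 (x⁻¹ v)]
      exact congrFun (x.apply_symm_apply v) i
    · rw [← ih.2 c]
      exact (x.symm_apply_apply _).trans (ih.2 c).symm

theorem isUnit_of_apply_single_eq {γ : LinAut C} {i k : C} {c : ℤ}
    (h : γ (Pi.single i 1) = Pi.single k c) : c = 1 ∨ c = -1 := by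
  have h1 : Pi.single i 1 = c • γ⁻¹ (Pi.single k 1) := by
    rw [← map_smul, ← Pi.single_smul, smul_eq_mul, mul_one, ← h]
    exact (γ.symm_apply_apply _).symm
  have h2 := congrFun h1 i
  rw [Pi.single_eq_same, Pi.smul_apply, smul_eq_mul] at h2
  exact Int.isUnit_iff.1 (IsUnit.of_mul_eq_one _ h2.symm)

theorem elemAut_zpow_apply {i j : C} (h : i ≠ j) (n : ℤ) (v : C → ℤ) :
    (elemAut i j ^ n) v = v + Pi.single j (n * v i) := by
  induction n with
  | zero => simp
  | succ n ih =>
    rw [zpow_add_one, (Commute.refl _).zpow_left n |>.eq, LinearEquiv.mul_apply, ih,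
      elemAut_apply h, Pi.add_apply, Pi.single_eq_of_ne h, add_zero, add_assoc, ← Pi.single_add,
      add_one_mul]
  | pred n ih =>
    rw [zpow_sub_one, ((Commute.refl (elemAut i j)).zpow_left _).inv_right.eq,
      LinearEquiv.mul_apply, ih, elemAut_inv_apply h, Pi.add_apply, Pi.single_eq_of_ne h, add_zero,
      add_sub_assoc, ← Pi.single_sub, sub_one_mul]

variable [Fintype C]

/-- The Euclidean algorithm for vectors. -/
theorem exists_elemSubgroup_apply_eq_single {D : Finset C} {v : C → ℤ} (hv : ∀ i ∈ D, v i = 0)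
    (hv0 : v ≠ 0) : ∃ h ∈ elemSubgroup D, ∃ k ∉ D, ∃ c, h v = Pi.single k c := by
  let μ : elemSubgroup D → ℕ := fun h => ∑ i, ((h : LinAut C) v i).natAbs
  obtain ⟨⟨h, hh⟩, hmin⟩ : ∃ h, ∀ h', μ h ≤ μ h' := by
    obtain ⟨_, ⟨h, rfl⟩, hh⟩ := WellFounded.has_min (wellFounded_lt (α := ℕ)) (Set.range μ)
      ⟨_, 1, rfl⟩
    exact ⟨h, fun h' => not_lt.1 (hh _ ⟨h', rfl⟩)⟩
  set w := h v with hw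
  have hwD : ∀ i ∈ D, w i = 0 := fun i hi => by
    rw [hw, (apply_of_mem_elemSubgroup hh i hi).1, hv i hi]
  have hw0 : w ≠ 0 := by
    rw [hw, Ne, EmbeddingLike.map_eq_zero_iff]
    exact hv0
  obtain ⟨k, hk⟩ := Function.ne_iff.1 hw0
  have hkD : k ∉ D := fun h => hk (hwD k h)
  have hstep : ∀ e ∈ elemSubgroup D, ∀ j, (∀ i ≠ j, e w i = w i) →
      (w j).natAbs ≤ (e w j).natAbs := by
    intro e he j hej
    have hle : ∑ i, (w i).natAbs ≤ ∑ i, (e w i).natAbs := hmin ⟨e * h, mul_mem he hh⟩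
    rw [← Finset.add_sum_erase _ _ (Finset.mem_univ j),
      ← Finset.add_sum_erase _ (fun i => (e w i).natAbs) (Finset.mem_univ j)] at hle
    rw [Finset.sum_congr rfl fun i hi => congrArg Int.natAbs
      (hej i (Finset.ne_of_mem_erase hi)).symm] at hle
    exact Nat.le_of_add_le_add_right hle
  have hpair : ∀ i j, i ∉ D → j ∉ D → i ≠ j → (w j).natAbs ≤ (w j + w i).natAbs ∧
      (w j).natAbs ≤ (w j - w i).natAbs := by
    intro i j hi hj hij
    have h1 := hstep _ (elemAut_mem hij hi hj) j fun l hl => by simp [elemAut_apply hij, hl]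
    have h2 := hstep _ (inv_mem (elemAut_mem hij hi hj)) j fun l hl => by
      simp [elemAut_inv_apply hij, hl]
    rw [elemAut_apply hij, Pi.add_apply, Pi.single_eq_same] at h1
    rw [elemAut_inv_apply hij, Pi.sub_apply, Pi.single_eq_same] at h2
    exact ⟨h1, h2⟩
  refine ⟨h, hh, k, hkD, w k, funext fun i => ?_⟩
  by_cases hik : i = k
  · rw [hik, Pi.single_eq_same]
  rw [Pi.single_eq_of_ne hik]
  by_cases hiD : i ∈ D
  · exact hwD i hiD
  have h1 := hpair i k hiD hkD hik
  have h2 := hpair k i hkD hiD (Ne.symm hik)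
  have h3 : w k ≠ 0 := hk
  change w i = 0
  clear_value w
  omega

/-- The automorphisms of `C → ℤ` given by diagonal sign matrices. -/
def signAuts (C : Type*) [DecidableEq C] : Set (LinAut C) :=
  {γ | ∀ i, γ (Pi.single i 1) = Pi.single i 1 ∨ γ (Pi.single i 1) = Pi.single i (-1)}

theorem linAut_ext_single {γ γ' : LinAut C}
    (h : ∀ i, γ (Pi.single i 1) = γ' (Pi.single i 1)) : γ = γ' := by
  refine LinearEquiv.toLinearMap_injective (LinearMap.pi_ext fun i c => ?_)
  have hc : (Pi.single i c : C → ℤ) = c • Pi.single i 1 := by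
    rw [← Pi.single_smul, smul_eq_mul, mul_one]
  rw [hc, map_smul, map_smul]
  exact congrArg _ (h i)

theorem finite_signAuts : (signAuts C).Finite := by
  refine Set.finite_coe_iff.1 (Finite.of_injective
    (fun (γ : signAuts C) (i : C) => decide ((γ : LinAut C) (Pi.single i 1) = Pi.single i 1))
    fun γ γ' h => Subtype.ext (linAut_ext_single fun i => ?_))
  have h1 := congrFun h i
  have hne : (Pi.single i (-1) : C → ℤ) ≠ Pi.single i 1 := fun h => by
    have := congrFun h i
    simp at this
  rcases γ.2 i with h2 | h2 <;> rcases γ'.2 i with h3 | h3 <;> simp_all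

theorem exists_shear (i : C) (n : C → ℤ) :
    ∃ s ∈ rootSubgroup (elemAut (C := C)) fun _ _ => True,
      s (Pi.single i 1) = Pi.single i 1 ∧
        ∀ j ≠ i, s (Pi.single j 1) = Pi.single j 1 + Pi.single i (n j) := by
  suffices hJ : ∀ J : Finset C, ∃ s ∈ rootSubgroup (elemAut (C := C)) fun _ _ => True,
      (∀ c, s (Pi.single i c) = Pi.single i c) ∧ ∀ j ≠ i, s (Pi.single j 1) =
        Pi.single j 1 + Pi.single i (if j ∈ J then n j else 0) by
    obtain ⟨s, hs, h1, h2⟩ := hJ Finset.univ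
    exact ⟨s, hs, h1 1, fun j hj => by simpa using h2 j hj⟩
  intro J
  induction J using Finset.induction with
  | empty => exact ⟨1, one_mem _, fun _ => rfl, fun j _ => by simp⟩
  | insert k J hk ih =>
    obtain ⟨s, hs, h1, h2⟩ := ih
    by_cases hki : k = i
    · refine ⟨s, hs, h1, fun j hj => ?_⟩
      rw [h2 j hj]
      simp [Finset.mem_insert, hki, hj]
    refine ⟨s * elemAut k i ^ n k, mul_mem hs (zpow_mem (IsSteinberg.mem_rootSubgroup hki trivial)
      _), fun c => ?_, fun j hj => ?_⟩
    · rw [LinearEquiv.mul_apply, elemAut_zpow_apply hki, Pi.single_eq_of_ne hki, mul_zero,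
        Pi.single_zero, add_zero, h1]
    · rw [LinearEquiv.mul_apply, elemAut_zpow_apply hki, map_add, h1, h2 j hj]
      by_cases hjk : j = k
      · subst hjk
        simp [hk]
      · simp [hjk, Ne.symm hjk]

/-- `GL_n(ℤ)` is generated by elementary and sign matrices. -/
theorem exists_mul_mul_mem_signAuts (β : LinAut C) :
    ∃ h ∈ rootSubgroup (elemAut (C := C)) fun _ _ => True,
      ∃ h' ∈ rootSubgroup (elemAut (C := C)) fun _ _ => True, h * β * h' ∈ signAuts C := by
  set H := rootSubgroup (elemAut (C := C)) fun _ _ => True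
  suffices hD : ∀ D : Finset C, ∃ h ∈ H, ∃ h' ∈ H, ∀ i ∈ D,
      ((h * β * h') (Pi.single i 1) = Pi.single i 1 ∨
        (h * β * h') (Pi.single i 1) = Pi.single i (-1)) ∧
      ∀ j ≠ i, (h * β * h') (Pi.single j 1) i = 0 by
    obtain ⟨h, hh, h', hh', h1⟩ := hD Finset.univ
    exact ⟨h, hh, h', hh', fun i => (h1 i (Finset.mem_univ i)).1⟩
  intro D
  induction D using Finset.induction with
  | empty => exact ⟨1, one_mem _, 1, one_mem _, by simp⟩
  | insert i D hi ih =>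
    obtain ⟨h, hh, h', hh', hγ⟩ := ih
    set γ := h * β * h' with hγdef
    obtain ⟨e, he, k, hk, c, hec⟩ := exists_elemSubgroup_apply_eq_single (D := D)
      (v := γ (Pi.single i 1)) (fun j hj => (hγ j hj).2 i (by rintro rfl; exact hi hj))
      (by rw [Ne, EmbeddingLike.map_eq_zero_iff, Pi.single_eq_zero_iff]; exact one_ne_zero)
    have hmove : ∃ e ∈ elemSubgroup D, ∃ c, e (γ (Pi.single i 1)) = Pi.single i c := by
      by_cases hki : k = i
      · exact ⟨e, he, c, hki ▸ hec⟩
      · refine ⟨(elemAut i k)⁻¹ * elemAut k i * e, mul_mem (mul_mem (inv_mem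
          (elemAut_mem (Ne.symm hki) hi hk)) (elemAut_mem hki hk hi)) he, c, ?_⟩
        rw [LinearEquiv.mul_apply, LinearEquiv.mul_apply, hec, elemAut_apply hki,
          elemAut_inv_apply (Ne.symm hki)]
        simp [Ne.symm hki]
    clear he hec e
    obtain ⟨e, he, c, hec⟩ := hmove
    have hc : c * c = 1 := by
      rcases isUnit_of_apply_single_eq (γ := e * γ) hec with rfl | rfl <;> rfl
    obtain ⟨s, hs, hsi, hsj⟩ := exists_shear i fun j => -c * (e * γ) (Pi.single j 1) i
    have hprod : e * h * β * (h' * s) = e * γ * s := by rw [hγdef]; group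
    refine ⟨e * h, mul_mem (elemSubgroup_le D he) hh, h' * s, mul_mem hh' hs, ?_⟩
    rw [hprod]
    have hDi : ∀ j ∈ D, j ≠ i := by rintro j hj rfl; exact hi hj
    have heD : ∀ j ∈ D, (e * γ) (Pi.single j 1) = Pi.single j 1 ∨
        (e * γ) (Pi.single j 1) = Pi.single j (-1) := by
      intro j hj
      rw [LinearEquiv.mul_apply]
      rcases (hγ j hj).1 with h1 | h1
      · exact Or.inl (by rw [h1, (apply_of_mem_elemSubgroup he j hj).2])
      · exact Or.inr (by rw [h1, (apply_of_mem_elemSubgroup he j hj).2])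
    have hmul : ∀ n : ℤ, (e * γ) (Pi.single i n) = Pi.single i (n * c) := by
      intro n
      have hn : (Pi.single i n : C → ℤ) = n • Pi.single i 1 := by
        rw [← Pi.single_smul, smul_eq_mul, mul_one]
      rw [hn, map_smul, LinearEquiv.mul_apply, hec, ← Pi.single_smul, smul_eq_mul]
    have hcol : ∀ l ≠ i, (e * γ * s) (Pi.single l 1) = (e * γ) (Pi.single l 1) +
        Pi.single i (-(e * γ) (Pi.single l 1) i) := by
      intro l hl
      rw [LinearEquiv.mul_apply, hsj l hl, map_add, hmul]
      congr 2
      linear_combination (-(e * γ) (Pi.single l 1) i) * hc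
    have hi1 : (e * γ * s) (Pi.single i 1) = Pi.single i c := by
      rw [LinearEquiv.mul_apply, hsi, hmul, one_mul]
    intro j hj
    rcases Finset.mem_insert.1 hj with rfl | hj
    · refine ⟨?_, fun l hl => by simp [hcol l hl]⟩
      rw [hi1]
      rcases isUnit_of_apply_single_eq (γ := e * γ) hec with rfl | rfl <;> simp
    · have hji := hDi j hj
      refine ⟨?_, fun l hl => ?_⟩
      · have h0 : (e * γ) (Pi.single j 1) i = 0 := by
          rcases heD j hj with h1 | h1 <;> rw [h1, Pi.single_eq_of_ne hji.symm]
        rw [hcol j hji, h0, neg_zero, Pi.single_zero, add_zero]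
        exact heD j hj
      · by_cases hli : l = i
        · rw [hli, hi1, Pi.single_eq_of_ne hji]
        · rw [hcol l hli, Pi.add_apply, Pi.single_eq_of_ne hji, add_zero, LinearEquiv.mul_apply,
            (apply_of_mem_elemSubgroup he j hj).1, (hγ j hj).2 l hl]

end Elementary

section FreeGroup

theorem eq_one_of_forall_commute_of {S : Type*} [Nontrivial S] {g : FreeGroup S}
    (hg : ∀ i, Commute g (FreeGroup.of i)) : g = 1 := by
  classical
  rcases hw : g.toWord with _ | ⟨⟨a, b⟩, w⟩
  · exact FreeGroup.toWord_eq_nil_iff.1 hw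
  obtain ⟨k, hk⟩ := exists_ne a
  have hred : FreeGroup.IsReduced ((k, true) :: g.toWord) := by
    have := FreeGroup.isReduced_toWord (x := g)
    rw [hw] at this ⊢
    exact FreeGroup.isReduced_cons_cons.2 ⟨fun h => absurd h hk, this⟩
  have hleft : (FreeGroup.of k * g).toWord = (k, true) :: g.toWord := by
    rw [FreeGroup.toWord_mul, FreeGroup.toWord_of]
    exact hred.reduce_eq
  have hsub := FreeGroup.toWord_mul_sublist g (FreeGroup.of k)
  rw [(hg k).eq, hleft, FreeGroup.toWord_of] at hsub
  have heq := hsub.eq_of_length (by simp)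
  rw [hw] at heq
  exact absurd (congrArg Prod.fst (List.cons.inj heq).1) hk

theorem commute_of_commute_of_ne_one {S : Type*} {g a b : FreeGroup S} (hg : g ≠ 1)
    (ha : Commute a g) (hb : Commute b g) : Commute a b := by
  let H := Subgroup.centralizer {g}
  have hmem : ∀ {x}, Commute x g → x ∈ H := fun hx =>
    Subgroup.mem_centralizer_singleton_iff.2 hx.eq
  let e := IsFreeGroup.toFreeGroup H
  have hcomm : ∀ x y : FreeGroup (IsFreeGroup.Generators H), x * y = y * x := by
    rcases subsingleton_or_nontrivial (IsFreeGroup.Generators H) with hX | hX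
    · have := Subgroup.isMulCommutative_closure
        (k := Set.range (FreeGroup.of (α := IsFreeGroup.Generators H))) (by
          rintro _ ⟨i, rfl⟩ _ ⟨j, rfl⟩
          rw [Subsingleton.elim i j])
      intro x y
      have hx : ∀ z, z ∈ Subgroup.closure
          (Set.range (FreeGroup.of (α := IsFreeGroup.Generators H))) := by
        simp [FreeGroup.closure_range_of]
      exact congrArg Subtype.val (mul_comm' (⟨x, hx x⟩ : Subgroup.closure _) ⟨y, hx y⟩)
    · have h1 : e ⟨g, hmem (Commute.refl g)⟩ = 1 := by
        refine eq_one_of_forall_commute_of fun i => ?_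
        obtain ⟨⟨x, hx⟩, hxi⟩ := e.surjective (FreeGroup.of i)
        rw [← hxi, Commute, SemiconjBy, ← map_mul, ← map_mul]
        exact congrArg e (Subtype.ext (Subgroup.mem_centralizer_singleton_iff.1 hx).symm)
      rw [EmbeddingLike.map_eq_one_iff] at h1
      exact absurd (congrArg Subtype.val h1) hg
  have h := e.injective (((e.map_mul ⟨a, hmem ha⟩ ⟨b, hmem hb⟩).trans (hcomm _ _)).trans
    (e.map_mul _ _).symm)
  exact congrArg Subtype.val h

end FreeGroup

section Pi

variable {ι : Type*} [DecidableEq ι] {F : ι → Type*} [∀ i, Group (F i)]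

/-- The factorwise automorphisms of a direct product. -/
def piAut : (∀ i, MulAut (F i)) →* MulAut (∀ i, F i) where
  toFun e := MulEquiv.piCongrRight e
  map_one' := rfl
  map_mul' _ _ := rfl

/-- A group in which commutation is transitive away from the identity, and which has trivial
center and is not trivial. -/
structure IsNonabelianCT (G : Type*) [Group G] : Prop where
  commute : ∀ g a b : G, g ≠ 1 → Commute a g → Commute b g → Commute a b
  center : ∀ g : G, (∀ x, Commute g x) → g = 1
  nontrivial : Nontrivial G

theorem isNonabelianCT_freeGroup (S : Type*) [Nontrivial S] : IsNonabelianCT (FreeGroup S) where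
  commute _ _ _ hg ha hb := commute_of_commute_of_ne_one hg ha hb
  center _ hg := eq_one_of_forall_commute_of fun _ => hg _
  nontrivial := inferInstance

theorem mulSingle_index_eq {i j : ι} {a : F i} {b : F j} (ha : a ≠ 1)
    (h : Pi.mulSingle i a = Pi.mulSingle j b) : i = j := by
  by_contra hij
  have := congrFun h i
  rw [Pi.mulSingle_eq_same, Pi.mulSingle_eq_of_ne hij] at this
  exact ha this

variable [Finite ι]

theorem monoidHom_pi_ext {N : Type*} [Group N] {f g : (∀ i, F i) →* N}
    (h : ∀ i a, f (Pi.mulSingle i a) = g (Pi.mulSingle i a)) : f = g :=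
  MonoidHom.ext fun x =>
    Subgroup.pi_mem_of_mulSingle_mem (H := f.eqLocus g) x fun i => h i (x i)

theorem exists_forall_ne_apply_mulSingle_eq_one (hF : ∀ i, IsNonabelianCT (F i))
    (γ : MulAut (∀ i, F i)) (j : ι) : ∃ i, ∀ k ≠ i, ∀ a, γ (Pi.mulSingle k a) j = 1 := by
  by_contra! H
  have := (hF j).nontrivial
  obtain ⟨i₀⟩ : Nonempty ι := ⟨j⟩
  obtain ⟨i, -, a, ha⟩ := H i₀
  obtain ⟨k, hki, b, hb⟩ := H i
  refine ha ((hF j).center _ fun x => ?_)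
  have hcomm : ∀ {l m : ι}, l ≠ m → ∀ a b,
      Commute (γ (Pi.mulSingle l a) j) (γ (Pi.mulSingle m b) j) := fun hlm a b =>
    ((Pi.mulSingle_commute hlm a b).map γ).map (Pi.evalMonoidHom F j)
  obtain ⟨f, hf⟩ := γ.surjective (Pi.mulSingle j x)
  let K := (Subgroup.centralizer {γ (Pi.mulSingle i a) j}).comap
    ((Pi.evalMonoidHom F j).comp γ.toMonoidHom)
  have hK : f ∈ K := by
    refine Subgroup.pi_mem_of_mulSingle_mem f fun l => ?_
    refine Subgroup.mem_centralizer_singleton_iff.2 ?_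
    change Commute (γ (Pi.mulSingle l (f l)) j) (γ (Pi.mulSingle i a) j)
    by_cases hl : l = i
    · subst hl
      exact (hF j).commute _ _ _ hb (hcomm hki.symm _ _) (hcomm hki.symm _ _)
    · exact hcomm hl _ _
  have := Subgroup.mem_centralizer_singleton_iff.1 hK
  change γ f j * _ = _ * γ f j at this
  rw [hf, Pi.mulSingle_eq_same] at this
  exact this.symm

/-- Automorphisms permute the factors. -/
theorem exists_perm_apply_mulSingle (hF : ∀ i, IsNonabelianCT (F i)) (γ : MulAut (∀ i, F i)) :
    ∃ σ : Equiv.Perm ι, ∀ i a, ∃ b, γ (Pi.mulSingle i a) = Pi.mulSingle (σ i) b := by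
  choose τ hτ using exists_forall_ne_apply_mulSingle_eq_one hF γ
  have hsurj : Function.Surjective τ := by
    intro i
    by_contra! h
    have := (hF i).nontrivial
    obtain ⟨a, ha⟩ := exists_ne (1 : F i)
    have h1 : γ (Pi.mulSingle i a) = 1 := funext fun j => hτ j i (h j).symm a
    rw [EmbeddingLike.map_eq_one_iff, Pi.mulSingle_eq_one_iff] at h1
    exact ha h1
  let e := Equiv.ofBijective τ (Finite.surjective_iff_bijective.1 hsurj)
  refine ⟨e.symm, fun i a => ⟨γ (Pi.mulSingle i a) (e.symm i), funext fun j => ?_⟩⟩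
  by_cases hj : j = e.symm i
  · subst hj
    rw [Pi.mulSingle_eq_same]
  · rw [Pi.mulSingle_eq_of_ne hj]
    refine hτ j i (fun h => hj ?_) a
    rw [h]
    exact (e.symm_apply_apply j).symm

theorem exists_piAut_eq {δ : MulAut (∀ i, F i)}
    (h : ∀ i a, ∃ b, δ (Pi.mulSingle i a) = Pi.mulSingle i b)
    (h' : ∀ i a, ∃ b, δ⁻¹ (Pi.mulSingle i a) = Pi.mulSingle i b) : ∃ e, piAut e = δ := by
  choose f hf using h
  choose f' hf' using h'
  have hinj : ∀ i, Function.Injective (Pi.mulSingle (M := F) i) := Pi.mulSingle_injective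
  let e : ∀ i, MulAut (F i) := fun i =>
    { toFun := f i
      invFun := f' i
      left_inv := fun a => hinj i (by rw [← hf', ← hf]; exact δ.symm_apply_apply _)
      right_inv := fun a => hinj i (by rw [← hf, ← hf']; exact δ.apply_symm_apply _)
      map_mul' := fun a b => hinj i (by
        rw [← hf, Pi.mulSingle_mul, Pi.mulSingle_mul, map_mul, hf, hf]) }
  refine ⟨e, MulEquiv.toMonoidHom_injective ?_⟩
  refine monoidHom_pi_ext fun i a => ?_
  change piAut e (Pi.mulSingle i a) = δ (Pi.mulSingle i a)
  rw [hf]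
  funext j
  change f j (Pi.mulSingle i a j) = _
  by_cases hj : j = i
  · subst hj
    rw [Pi.mulSingle_eq_same, Pi.mulSingle_eq_same]
  · rw [Pi.mulSingle_eq_of_ne hj, Pi.mulSingle_eq_of_ne hj]
    exact map_one (e j)

theorem exists_finite_cosets_piAut (hF : ∀ i, IsNonabelianCT (F i)) :
    ∃ c : MulAut (∀ i, F i) → Equiv.Perm ι,
      ∀ γ γ', c γ = c γ' → γ'⁻¹ * γ ∈ (piAut (F := F)).range := by
  choose c hc using exists_perm_apply_mulSingle hF
  have key : ∀ γ γ', c γ = c γ' → ∀ i a, ∃ b, (γ'⁻¹ * γ) (Pi.mulSingle i a) = Pi.mulSingle i b := by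
    intro γ γ' h i a
    obtain ⟨b, hb⟩ := h ▸ hc γ i a
    have := (hF i).nontrivial
    obtain ⟨x, hx⟩ := exists_ne (1 : F i)
    obtain ⟨y, hy⟩ := hc γ' i x
    obtain ⟨z, hz⟩ := hc γ'⁻¹ (c γ' i) y
    rw [← hy, MulAut.inv_apply_self] at hz
    have hi := mulSingle_index_eq hx hz
    have hw := hc γ'⁻¹ (c γ' i) b
    rw [← hi] at hw
    rwa [MulAut.mul_apply, hb]
  refine ⟨c, fun γ γ' h => ?_⟩
  refine exists_piAut_eq (key γ γ' h) ?_
  rw [mul_inv_rev, inv_inv]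
  exact key γ' γ h.symm

end Pi

section Prod

variable {Z P : Type*} [CommGroup Z] [Group P]

/-- The automorphisms of a direct product preserving both factors. -/
def prodAut : MulAut Z × MulAut P →* MulAut (Z × P) where
  toFun e := MulEquiv.prodCongr e.1 e.2
  map_one' := rfl
  map_mul' _ _ := rfl

theorem prodAut_apply (e : MulAut Z × MulAut P) (x : Z × P) :
    prodAut e x = (e.1 x.1, e.2 x.2) := rfl

/-- The automorphism `(z, f) ↦ (z * ζ f, f)`. -/
def shear : (P →* Z) →* MulAut (Z × P) where
  toFun ζ :=
    { toFun := fun x => (x.1 * ζ x.2, x.2)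
      invFun := fun x => (x.1 * (ζ x.2)⁻¹, x.2)
      left_inv := fun x => by simp
      right_inv := fun x => by simp
      map_mul' := fun x y => by
        simp only [Prod.snd_mul, Prod.fst_mul, map_mul, Prod.mk_mul_mk]
        rw [mul_mul_mul_comm] }
  map_one' := by ext x <;> simp
  map_mul' ζ ζ' := MulEquiv.ext fun x => by
    refine Prod.ext ?_ rfl
    change x.1 * (ζ x.2 * ζ' x.2) = x.1 * ζ' x.2 * ζ x.2
    rw [mul_assoc, mul_comm (ζ x.2)]

theorem shear_apply (ζ : P →* Z) (x : Z × P) : shear ζ x = (x.1 * ζ x.2, x.2) := rfl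

theorem exists_eq_prodAut_mul_shear (hP : ∀ g : P, (∀ x, Commute g x) → g = 1)
    (α : MulAut (Z × P)) : ∃ e ζ, α = prodAut e * shear ζ := by
  have hcentral : ∀ (α : MulAut (Z × P)) (z : Z), (α (z, 1)).2 = 1 := by
    intro α z
    refine hP _ fun x => ?_
    obtain ⟨⟨w, y⟩, hwy⟩ := α.surjective (1, x)
    have h1 : Commute ((z, 1) : Z × P) (w, y) := Prod.ext (mul_comm _ _) (by simp)
    have h2 := (h1.map α).map (MonoidHom.snd Z P)
    rw [hwy] at h2
    exact h2
  have hβ : ∀ (α : MulAut (Z × P)) (z : Z), α (z, 1) = ((α (z, 1)).1, 1) := fun α z =>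
    Prod.ext rfl (hcentral α z)
  have hγ : ∀ (α : MulAut (Z × P)) (f : P), (α⁻¹ (1, (α (1, f)).2)).2 = f := by
    intro α f
    have h1 : ((1, (α (1, f)).2) : Z × P) = ((α (1, f)).1⁻¹, 1) * α (1, f) := by
      refine Prod.ext ?_ ?_ <;> simp
    rw [h1, map_mul, MulAut.inv_apply_self, Prod.snd_mul, hcentral, one_mul]
  let β : MulAut Z :=
    { toFun := fun z => (α (z, 1)).1
      invFun := fun z => (α⁻¹ (z, 1)).1
      left_inv := fun z => by
        change (α⁻¹ ((α (z, 1)).1, 1)).1 = z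
        rw [← hβ α, MulAut.inv_apply_self]
      right_inv := fun z => by
        change (α ((α⁻¹ (z, 1)).1, 1)).1 = z
        rw [← hβ α⁻¹, MulAut.apply_inv_self]
      map_mul' := fun z w => by
        rw [← Prod.fst_mul, ← map_mul, Prod.mk_mul_mk, one_mul] }
  let γ : MulAut P :=
    { toFun := fun f => (α (1, f)).2
      invFun := fun f => (α⁻¹ (1, f)).2
      left_inv := fun f => hγ α f
      right_inv := fun f => by
        have := hγ α⁻¹ f
        rwa [inv_inv] at this
      map_mul' := fun f g => by
        rw [← Prod.snd_mul, ← map_mul, Prod.mk_mul_mk, one_mul] }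
  let ζ : P →* Z := β⁻¹.toMonoidHom.comp
    ((MonoidHom.fst Z P).comp (α.toMonoidHom.comp (MonoidHom.inr Z P)))
  refine ⟨(β, γ), ζ, MulEquiv.ext fun ⟨z, f⟩ => ?_⟩
  have h1 : ((z, f) : Z × P) = (z, 1) * (1, f) := by simp
  rw [MulAut.mul_apply, shear_apply, prodAut_apply, map_mul]
  change _ = (β z * β (β⁻¹ (α (1, f)).1), (α (1, f)).2)
  rw [MulAut.apply_inv_self, h1, map_mul, hβ α z]
  refine Prod.ext rfl (one_mul _)

end Prod

/-- Automorphisms of the free abelian group `C → ℤ`, written multiplicatively. -/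
def linToMulAut (C : Type*) : ((C → ℤ) ≃ₗ[ℤ] (C → ℤ)) →* MulAut (Multiplicative (C → ℤ)) where
  toFun β := AddEquiv.toMultiplicative β.toAddEquiv
  map_one' := rfl
  map_mul' _ _ := rfl

theorem linToMulAut_surjective (C : Type*) : Function.Surjective (linToMulAut C) := fun β =>
  ⟨(AddEquiv.toMultiplicative.symm β).toIntLinearEquiv, rfl⟩

theorem isOfFinOrder_apply_of_finite_range {G Q : Type*} [Group G] [Group Q] {f : G →* Q}
    (hf : Finite f.range) (x : G) : IsOfFinOrder (f x) :=
  Submonoid.isOfFinOrder_coe.2 (isOfFinOrder_of_finite (⟨f x, x, rfl⟩ : f.range))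

theorem finite_range_of_cosets {G Q κ : Type*} [Group G] [Group Q] [Finite κ] {f : G →* Q}
    {K : Set Q} (hK : K.Finite) (c : G → κ) (hc : ∀ g g', c g = c g' → f (g'⁻¹ * g) ∈ K) :
    Finite f.range := by
  have hfib : ∀ k, {q | ∃ g, c g = k ∧ f g = q}.Finite := by
    intro k
    rcases Set.eq_empty_or_nonempty {q | ∃ g, c g = k ∧ f g = q} with h | ⟨_, g', rfl, rfl⟩
    · rw [h]
      exact Set.finite_empty
    refine (hK.image (f g' * ·)).subset ?_
    rintro _ ⟨g, hg, rfl⟩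
    exact ⟨_, hc g g' hg, by simp⟩
  refine ((Set.finite_iUnion hfib).subset ?_).to_subtype
  rintro _ ⟨g, rfl⟩
  exact Set.mem_iUnion.2 ⟨c g, g, rfl, rfl⟩

/-- The automorphism `α` acts trivially on the abelianization. -/
def ActsTrivially {G : Type*} [Group G] (α : MulAut G) : Prop :=
  ∀ g, Abelianization.of (α g) = Abelianization.of g

theorem freeGroup_mulAut_ext {S : Type*} {α β : MulAut (FreeGroup S)}
    (h : ∀ k, α (FreeGroup.of k) = β (FreeGroup.of k)) : α = β :=
  MulEquiv.toMonoidHom_injective (FreeGroup.ext_hom _ _ h)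

theorem actsTrivially_freeGroup {S : Type*} {α : MulAut (FreeGroup S)}
    (h : ∀ k, Abelianization.of (α (FreeGroup.of k)) = Abelianization.of (FreeGroup.of k)) :
    ActsTrivially α :=
  DFunLike.congr_fun (f := Abelianization.of.comp α.toMonoidHom) (g := Abelianization.of)
    (FreeGroup.ext_hom _ _ h)

section Transvections

variable {S : Type*} [DecidableEq S]

theorem transv_rel (b : Bool) {i j k : S} (hij : i ≠ j) (hjk : j ≠ k) (hik : i ≠ k) :
    transv b j k * transv b i j = transv b i j * transv b i k * transv b j k := by
  refine freeGroup_mulAut_ext fun l => ?_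
  have hlk := transv_of_ne b hik.symm j
  have hkk := transv_of_ne b hik.symm k
  have hlk' := transv_of_ne b hjk.symm k
  have hji := transv_of_ne b hij.symm j
  have hji' := transv_of_ne b hij.symm k
  have hij' := transv_of_ne b hij k
  by_cases hi : l = i
  · subst hi
    cases b <;> simp [transv_of_self _ hij, transv_of_self _ hjk, transv_of_self _ hik, *, mul_assoc]
  by_cases hj : l = j
  · subst hj
    cases b <;> simp [transv_of_self _ hjk, *]
  · simp [transv_of_ne b hi, transv_of_ne b hj]

theorem transv_commute (b b' : Bool) {i j k l : S} (hij : i ≠ j) (hkl : k ≠ l) (hik : i ≠ k)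
    (hjk : j ≠ k) (hil : i ≠ l) : Commute (transv b i j) (transv b' k l) := by
  refine freeGroup_mulAut_ext fun m => ?_
  have h1 := transv_of_ne b hik.symm j
  have h2 := transv_of_ne b hil.symm j
  have h3 := transv_of_ne b' hik l
  have h4 := transv_of_ne b' hjk l
  by_cases hi : m = i
  · subst hi
    cases b <;> simp [transv_of_self _ hij, *]
  by_cases hk : m = k
  · subst hk
    cases b' <;> simp [transv_of_self _ hkl, *]
  · simp [transv_of_ne b hi, transv_of_ne b' hk]

theorem transv_commute_not (b : Bool) {i j k : S} (hij : i ≠ j) (hik : i ≠ k) :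
    Commute (transv b i j) (transv (!b) i k) := by
  refine freeGroup_mulAut_ext fun m => ?_
  by_cases hi : m = i
  · subst hi
    cases b <;> simp [transv_of_self _ hij, transv_of_self _ hik, transv_of_ne _ hij.symm,
      transv_of_ne _ hik.symm, mul_assoc]
  · simp [transv_of_ne _ hi]

theorem actsTrivially_transv_mul_inv (b : Bool) {i j : S} (hij : i ≠ j) :
    ActsTrivially (transv (!b) i j * (transv b i j)⁻¹) := by
  refine actsTrivially_freeGroup fun m => ?_
  by_cases hi : m = i
  · subst hi
    cases b <;> simp [transv_of_self _ hij, transv_inv_of_self _ hij, transv_of_ne _ hij.symm]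
  · rw [MulAut.mul_apply, transv_inv_of_ne b hi, transv_of_ne _ hi]

variable {Q : Type*} [Group Q] {T : Subgroup Q} {p : MulAut (FreeGroup S) →* Q}

theorem isOfFinOrder_transv (hT : IsLatticeLike T) (hp : ∀ α, ActsTrivially α → p α ∈ T)
    (h3 : ∀ i j : S, ∃ k, k ≠ i ∧ k ≠ j) (b : Bool) {i k : S} (hik : i ≠ k) :
    IsOfFinOrder (p (transv b i k)) := by
  obtain ⟨j, hji, hjk⟩ := h3 i k
  refine hT.isOfFinOrder_of_conj_eq (a := p (transv b i j)⁻¹) (a' := p (transv (!b) i j)⁻¹)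
    (b := p (transv b j k)) ?_ ?_ ?_ ?_
  · rw [← map_inv, ← map_mul, ← map_mul, ← map_mul, inv_inv, mul_assoc,
      transv_rel b hji.symm hjk hik, mul_assoc, inv_mul_cancel_left]
  · exact (transv_commute b b hik hjk hji.symm hjk.symm hik).map p
  · rw [← map_inv, ← map_mul, inv_inv]
    exact hp _ (actsTrivially_transv_mul_inv b hji.symm)
  · exact (transv_commute_not b hik hji.symm).symm.inv_left.map p

theorem map_transv_not (hT : IsLatticeLike T) (hp : ∀ α, ActsTrivially α → p α ∈ T)
    (h3 : ∀ i j : S, ∃ k, k ≠ i ∧ k ≠ j) (b : Bool) {i j : S} (hij : i ≠ j) :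
    p (transv (!b) i j) = p (transv b i j) := by
  have hcomm : Commute (p (transv (!b) i j)) (p (transv b i j)⁻¹) :=
    (transv_commute_not b hij hij).symm.inv_right.map p
  have h := hT.torsionFree _ (hp _ (actsTrivially_transv_mul_inv b hij)) (by
    rw [map_mul]
    refine hcomm.isOfFinOrder_mul (isOfFinOrder_transv hT hp h3 _ hij) ?_
    rw [map_inv]
    exact (isOfFinOrder_transv hT hp h3 _ hij).inv)
  rwa [map_mul, map_inv, mul_inv_eq_one] at h

theorem isSteinberg_map_transv (hT : IsLatticeLike T) (hp : ∀ α, ActsTrivially α → p α ∈ T)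
    (h3 : ∀ i j : S, ∃ k, k ≠ i ∧ k ≠ j) : IsSteinberg fun i j => p (transv true i j) where
  commute i j k l hij hkl hjk hil := by
    by_cases hik : i = k
    · subst hik
      rw [← map_transv_not hT hp h3 true hkl]
      exact (transv_commute_not true hij hkl).map p
    · exact (transv_commute true true hij hkl hik hjk hil).map p
  rel i j k hij hjk hik := by
    rw [← map_mul, ← map_mul, ← map_mul, transv_rel true hij hjk hik]

theorem finite_range_of_mulAut_freeGroup [Fintype S] [Nontrivial S] (hT : IsLatticeLike T)
    (hp : ∀ α, ActsTrivially α → p α ∈ T) (h3 : ∀ i j : S, ∃ k, k ≠ i ∧ k ≠ j) :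
    Finite p.range := by
  obtain ⟨a, b, hab⟩ := exists_pair_ne S
  obtain ⟨c, hca, hcb⟩ := h3 a b
  have hfin := (isSteinberg_map_transv hT hp h3).finite_closure hT
    (fun i j hij => isOfFinOrder_transv hT hp h3 true hij) hab hca hcb
  set K := rootSubgroup (fun i j => p (transv true i j)) fun _ _ => True
  have hle : transvSubgroup S ≤ K.comap p := by
    refine (Subgroup.closure_le _).2 ?_
    rintro _ ⟨b, i, j, hij, rfl⟩
    have hmem : p (transv true i j) ∈ K := IsSteinberg.mem_rootSubgroup hij trivial
    cases b
    · change p (transv (!true) i j) ∈ K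
      rwa [map_transv_not hT hp h3 true hij]
    · exact hmem
  have hfinK : (K : Set Q).Finite := Set.finite_coe_iff.1 hfin
  refine ((((finite_signedPerms S).image p).image2 (fun s k => s⁻¹ * k⁻¹) hfinK).subset
    ?_).to_subtype
  rintro _ ⟨α, rfl⟩
  obtain ⟨h, hh, hs⟩ := exists_mul_inv_mem_signedPerms α
  exact ⟨_, ⟨_, hs, rfl⟩, _, hle hh, by simp⟩

end Transvections

theorem finite_range_of_linAut {C Q : Type*} [Fintype C] [DecidableEq C] [Group Q]
    {T : Subgroup Q} {p : LinAut C →* Q} (hT : IsLatticeLike T)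
    (h3 : ∀ i j : C, i ≠ j → ∃ k, k ≠ i ∧ k ≠ j) : Finite p.range := by
  have hst : IsSteinberg fun i j => p (elemAut i j) :=
    { commute := fun i j k l hij hkl hjk hil =>
        (isSteinberg_elemAut.commute i j k l hij hkl hjk hil).map p
      rel := fun i j k hij hjk hik => by
        rw [← map_mul, ← map_mul, ← map_mul, isSteinberg_elemAut.rel i j k hij hjk hik] }
  have htor : ∀ i j, i ≠ j → IsOfFinOrder (p (elemAut i j)) := by
    intro i k hik
    obtain ⟨j, hji, hjk⟩ := h3 i k hik
    refine hT.isOfFinOrder_of_conj_eq (a := (p (elemAut i j))⁻¹) (a' := (p (elemAut i j))⁻¹)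
      (b := p (elemAut j k)) ?_ ?_ ?_ ?_
    · rw [inv_inv, mul_assoc, hst.rel i j k hji.symm hjk hik, mul_assoc, inv_mul_cancel_left]
    · exact hst.commute i k j k hik hjk hjk.symm hik
    · rw [inv_mul_cancel]
      exact T.one_mem
    · exact (hst.commute i j i k hji.symm hik hji hik).inv_left
  set K := rootSubgroup (fun i j => p (elemAut i j)) fun _ _ => True with hK
  have hfin : Finite K := by
    rcases subsingleton_or_nontrivial C with hC | hC
    · have : K = ⊥ := by
        rw [eq_bot_iff]
        exact IsSteinberg.rootSubgroup_le fun i j hij => absurd (Subsingleton.elim i j) hij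
      rw [this]
      infer_instance
    · obtain ⟨a, b, hab⟩ := exists_pair_ne C
      obtain ⟨c, hca, hcb⟩ := h3 a b hab
      exact hst.finite_closure hT htor hab hca hcb
  have hle : rootSubgroup elemAut (fun _ _ : C => True) ≤ K.comap p :=
    IsSteinberg.rootSubgroup_le fun i j hij _ => IsSteinberg.mem_rootSubgroup hij trivial
  have hfinK : (K : Set Q).Finite := Set.finite_coe_iff.1 hfin
  refine ((hfinK.image2 (fun k s => k * s) (((finite_signAuts (C := C)).image p).image2
    (fun s k => s * k) hfinK)).subset ?_).to_subtype
  rintro _ ⟨β, rfl⟩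
  obtain ⟨h, hh, h', hh', hs⟩ := exists_mul_mul_mem_signAuts β
  refine ⟨_, K.inv_mem (hle hh), _, ⟨_, ⟨_, hs, rfl⟩, _, K.inv_mem (hle hh'), rfl⟩, ?_⟩
  simp [mul_assoc]

section Product

/-- The direct product of a free abelian group and free groups. -/
abbrev FreeProd (C : Type*) {ι : Type*} (S : ι → Type*) :=
  Multiplicative (C → ℤ) × ∀ i, FreeGroup (S i)

variable {ι : Type*} [DecidableEq ι] {C : Type*} {S : ι → Type*}

variable (C S) in
/-- The automorphisms of the `i`-th free factor. -/
def factorAut (i : ι) : MulAut (FreeGroup (S i)) →* MulAut (FreeProd C S) :=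
  prodAut.comp ((MonoidHom.inr _ _).comp
    (piAut.comp (MonoidHom.mulSingle (fun i => MulAut (FreeGroup (S i))) i)))

theorem factorAut_apply (i : ι) (α : MulAut (FreeGroup (S i))) (x : FreeProd C S) :
    factorAut C S i α x =
      (x.1, fun j => Pi.mulSingle (M := fun i => MulAut (FreeGroup (S i))) i α j (x.2 j)) := rfl

theorem factorAut_apply_snd (i : ι) (α : MulAut (FreeGroup (S i))) (x : FreeProd C S) :
    (factorAut C S i α x).2 i = α (x.2 i) := by
  rw [factorAut_apply]
  change Pi.mulSingle (M := fun i => MulAut (FreeGroup (S i))) i α i (x.2 i) = _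
  rw [Pi.mulSingle_eq_same]

theorem factorAut_apply_eq_mul (i : ι) (α : MulAut (FreeGroup (S i))) (x : FreeProd C S) :
    factorAut C S i α x = x * (1, Pi.mulSingle i ((x.2 i)⁻¹ * α (x.2 i))) := by
  refine Prod.ext (mul_one _).symm (funext fun j => ?_)
  by_cases hj : j = i
  · subst hj
    rw [factorAut_apply_snd]
    simp
  · rw [factorAut_apply]
    simp [Pi.mulSingle_eq_of_ne hj]

theorem ActsTrivially.factorAut {i : ι} {α : MulAut (FreeGroup (S i))} (hα : ActsTrivially α) :
    ActsTrivially (factorAut C S i α) := by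
  intro x
  let j : FreeGroup (S i) →* FreeProd C S :=
    (MonoidHom.inr _ _).comp (MonoidHom.mulSingle (fun i => FreeGroup (S i)) i)
  have h : Abelianization.of (j ((x.2 i)⁻¹ * α (x.2 i))) = 1 := by
    rw [← Abelianization.map_of, map_mul, map_inv, hα, inv_mul_cancel, map_one]
  rw [factorAut_apply_eq_mul, map_mul]
  exact mul_eq_left.2 h

/-- A homomorphism from a free factor to the center, composed with the projection. -/
def factorHom (i : ι) (θ : FreeGroup (S i) →* Multiplicative (C → ℤ)) :
    (∀ i, FreeGroup (S i)) →* Multiplicative (C → ℤ) :=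
  θ.comp (Pi.evalMonoidHom _ i)

theorem factorAut_mul_shear (i : ι) (α : MulAut (FreeGroup (S i)))
    (θ : FreeGroup (S i) →* Multiplicative (C → ℤ)) :
    (factorAut C S i α)⁻¹ * shear (factorHom i θ) * factorAut C S i α =
      shear (factorHom i (θ.comp α.toMonoidHom)) := by
  rw [mul_assoc, inv_mul_eq_iff_eq_mul]
  refine MulEquiv.ext fun x => Prod.ext ?_ rfl
  change x.1 * θ ((factorAut C S i α x).2 i) = x.1 * θ (α (x.2 i))
  rw [factorAut_apply_snd]

variable {Q : Type*} [Group Q] {T : Subgroup Q} {p : MulAut (FreeProd C S) →* Q}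

/-- The homomorphism from a free group sending one generator to `z` and the others to `1`. -/
def singleHom {S Z : Type*} [DecidableEq S] [Group Z] (s : S) (z : Z) : FreeGroup S →* Z :=
  FreeGroup.lift (Pi.mulSingle s z)

theorem isOfFinOrder_shear_singleHom [∀ i, DecidableEq (S i)] (hT : IsLatticeLike T)
    (h3 : ∀ i, ∀ j : S i, ∃ k, k ≠ j) (i : ι) (s : S i) (z : Multiplicative (C → ℤ)) :
    IsOfFinOrder (p (shear (factorHom i (singleHom s z)))) := by
  obtain ⟨u, hus⟩ := h3 i s
  let a := factorAut C S i (transv false s u)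
  have hb : a⁻¹ * shear (factorHom i (singleHom u z)) * a =
      shear (factorHom i (singleHom s z)) * shear (factorHom i (singleHom u z)) := by
    rw [factorAut_mul_shear, ← map_mul]
    change _ = shear (factorHom i (singleHom s z * singleHom u z))
    refine congrArg (fun θ => shear (factorHom i θ)) (FreeGroup.ext_hom _ _ fun m => ?_)
    by_cases hm : m = s
    · subst hm
      simp [singleHom, transv_of_self false hus.symm, hus.symm]
    · simp [singleHom, transv_of_ne false hm, hm]
  have hc : a⁻¹ * shear (factorHom i (singleHom s z)) * a =
      shear (factorHom i (singleHom s z)) := by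
    rw [factorAut_mul_shear]
    refine congrArg (fun θ => shear (factorHom i θ)) (FreeGroup.ext_hom _ _ fun m => ?_)
    by_cases hm : m = s
    · subst hm
      simp [singleHom, transv_of_self false hus.symm, hus]
    · simp [singleHom, transv_of_ne false hm]
  refine hT.isOfFinOrder_of_conj_eq (a := (p a)⁻¹) (a' := (p a)⁻¹)
    (b := p (shear (factorHom i (singleHom u z)))) ?_ ?_ ?_ ?_
  · rw [inv_inv, ← map_inv, ← map_mul, ← map_mul, ← map_mul, hb]
  · exact ((Commute.all (factorHom i (singleHom s z)) (factorHom i (singleHom u z))).map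
      shear).map p
  · rw [inv_mul_cancel]
    exact T.one_mem
  · rw [← map_inv]
    refine Commute.map ?_ p
    rw [Commute, SemiconjBy, ← mul_inv_eq_iff_eq_mul, inv_inv, hc]

variable [Fintype ι] [∀ i, Fintype (S i)] [∀ i, DecidableEq (S i)]

theorem eq_prod_factorHom (ζ : (∀ i, FreeGroup (S i)) →* Multiplicative (C → ℤ)) :
    ζ = ∏ i, ∏ s : S i, factorHom i (singleHom s (ζ (Pi.mulSingle i (FreeGroup.of s)))) := by
  refine monoidHom_pi_ext fun i a => ?_
  refine DFunLike.congr_fun (f := ζ.comp (MonoidHom.mulSingle (fun i => FreeGroup (S i)) i))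
    (g := MonoidHom.comp _ (MonoidHom.mulSingle (fun i => FreeGroup (S i)) i))
    (FreeGroup.ext_hom _ _ fun s => ?_) a
  simp only [MonoidHom.comp_apply, MonoidHom.mulSingle_apply, MonoidHom.finsetProd_apply]
  rw [Finset.prod_eq_single i, Finset.prod_eq_single s]
  · simp [factorHom, singleHom]
  · intro t _ ht
    simp [factorHom, singleHom, ht.symm]
  · simp
  · intro j _ hj
    refine Finset.prod_eq_one fun t _ => ?_
    simp [factorHom, hj]
  · simp

theorem finite_range_shear (hT : IsLatticeLike T) (h3 : ∀ i, ∀ j : S i, ∃ k, k ≠ j) :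
    Finite (p.comp shear).range := by
  refine hT.finite_of_torsion ?_
  rintro _ ⟨ζ, rfl⟩
  let H : Subgroup ((∀ i, FreeGroup (S i)) →* Multiplicative (C → ℤ)) :=
    { carrier := {ζ | IsOfFinOrder (p (shear ζ))}
      one_mem' := by simp
      mul_mem' := fun {ζ ζ'} h h' => by
        change IsOfFinOrder _
        rw [map_mul, map_mul]
        exact (((Commute.all ζ ζ').map shear).map p).isOfFinOrder_mul h h'
      inv_mem' := fun {ζ} h => by
        change IsOfFinOrder _
        rw [map_inv, map_inv]
        exact IsOfFinOrder.inv h }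
  change ζ ∈ H
  rw [eq_prod_factorHom ζ]
  exact H.prod_mem fun i _ => H.prod_mem fun s _ => isOfFinOrder_shear_singleHom hT h3 i s _

theorem finite_range_piAut {F : ι → Type*} [∀ i, Group (F i)] {p : MulAut (∀ i, F i) →* Q}
    (hT : IsLatticeLike T) (hF : ∀ i, IsNonabelianCT (F i))
    (hp : ∀ i, Finite (p.comp (piAut.comp
      (MonoidHom.mulSingle (fun i => MulAut (F i)) i))).range) : Finite p.range := by
  have hpi : Finite (p.comp (piAut (F := F))).range := by
    refine hT.finite_of_torsion ?_
    rintro _ ⟨e, rfl⟩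
    rw [hT.isOfFinOrder_iff, ← map_pow]
    refine Subgroup.pi_mem_of_mulSingle_mem (H := (p.comp (piAut (F := F))).ker) _ fun i => ?_
    rw [Pi.pow_apply, Pi.mulSingle_pow, MonoidHom.mem_ker, map_pow]
    exact hT.pow_index_eq_one (isOfFinOrder_apply_of_finite_range (hp i) (e i))
  obtain ⟨c, hc⟩ := exists_finite_cosets_piAut hF
  refine finite_range_of_cosets (Set.finite_coe_iff.1 hpi) c fun γ γ' h => ?_
  obtain ⟨e, he⟩ := hc γ γ' h
  exact ⟨e, congrArg p he⟩

theorem finite_range_mulAut_freeProd [Fintype C] [DecidableEq C] (hT : IsLatticeLike T)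
    (hp : ∀ α, ActsTrivially α → p α ∈ T) (hne : ∀ i, Nonempty (S i))
    (hS : ∀ i, ∀ j k : S i, ∃ l, l ≠ j ∧ l ≠ k)
    (hC : ∀ i j : C, i ≠ j → ∃ k, k ≠ i ∧ k ≠ j) : Finite p.range := by
  have hnt : ∀ i, Nontrivial (S i) := fun i =>
    let ⟨s⟩ := hne i
    let ⟨l, hl, _⟩ := hS i s s
    ⟨l, s, hl⟩
  have hCT : ∀ i, IsNonabelianCT (FreeGroup (S i)) := fun i => isNonabelianCT_freeGroup (S i)
  have hlin : Finite (p.comp (prodAut.comp ((MonoidHom.inl _ _).comp (linToMulAut C)))).range :=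
    finite_range_of_linAut hT hC
  have hpi : Finite (p.comp (prodAut.comp (MonoidHom.inr _ _))).range :=
    finite_range_piAut hT hCT fun i => finite_range_of_mulAut_freeGroup
      (p := p.comp (factorAut C S i)) hT (fun α hα => hp _ hα.factorAut) (hS i)
  have hsh : Finite (p.comp shear).range :=
    finite_range_shear hT fun i j => let ⟨l, hl, _⟩ := hS i j j; ⟨l, hl⟩
  refine (((Set.finite_coe_iff.1 hlin).image2 (fun a b => a * b)
    ((Set.finite_coe_iff.1 hpi).image2 (fun a b => a * b)
      (Set.finite_coe_iff.1 hsh))).subset ?_).to_subtype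
  rintro _ ⟨α, rfl⟩
  obtain ⟨⟨β, γ⟩, ζ, rfl⟩ := exists_eq_prodAut_mul_shear (fun g hg => funext fun i =>
    (hCT i).center _ fun x => by
      simpa using (hg (Pi.mulSingle i x)).map (Pi.evalMonoidHom _ i)) α
  obtain ⟨β, rfl⟩ := linToMulAut_surjective C β
  refine ⟨_, ⟨β, rfl⟩, _, ⟨_, ⟨γ, rfl⟩, _, ⟨ζ, rfl⟩, rfl⟩, ?_⟩
  simp only [MonoidHom.comp_apply]
  rw [← map_mul, ← map_mul, ← mul_assoc, ← map_mul]
  simp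

end Product

section Vanishing

universe u

variable {M : Type u} [Group M]

/-- The elements of `N` killed by every homomorphism from `N` to `ℤ`. -/
def intKernel (N : Subgroup M) : Subgroup N := ⨅ ψ : N →* Multiplicative ℤ, ψ.ker

theorem mem_intKernel {N : Subgroup M} {n : N} :
    n ∈ intKernel N ↔ ∀ ψ : N →* Multiplicative ℤ, ψ n = 1 := by
  simp [intKernel, Subgroup.mem_iInf]

instance characteristic_intKernel (N : Subgroup M) : (intKernel N).Characteristic :=
  Subgroup.characteristic_iff_le_comap.2 fun e _ hn =>
    mem_intKernel.2 fun ψ => mem_intKernel.1 hn (ψ.comp e.toMonoidHom)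

theorem isLatticeLike_map_mk (N : Subgroup M) [N.Normal] [N.FiniteIndex] :
    IsLatticeLike (N.map (QuotientGroup.mk' ((intKernel N).map N.subtype))) where
  normal := Subgroup.Normal.map inferInstance _ (QuotientGroup.mk'_surjective _)
  finiteIndex := ⟨fun h => Subgroup.FiniteIndex.index_ne_zero (H := N)
    (Nat.eq_zero_of_zero_dvd (h ▸ Subgroup.index_map_dvd N (QuotientGroup.mk'_surjective _)))⟩
  comm := by
    rintro _ ⟨n, hn, rfl⟩ _ ⟨m, hm, rfl⟩
    rw [← map_mul, ← map_mul]
    refine QuotientGroup.eq.2 ⟨(⟨n, hn⟩ * ⟨m, hm⟩)⁻¹ * (⟨m, hm⟩ * ⟨n, hn⟩), ?_, rfl⟩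
    refine mem_intKernel.2 fun ψ => ?_
    rw [map_mul, map_inv, map_mul, map_mul, mul_comm (ψ ⟨m, hm⟩), inv_mul_cancel]
  torsionFree := by
    rintro _ ⟨n, hn, rfl⟩ hfin
    obtain ⟨k, hk, hpow⟩ := isOfFinOrder_iff_pow_eq_one.1 hfin
    rw [← map_pow] at hpow
    obtain ⟨x, hx, hxn⟩ := (QuotientGroup.eq_one_iff _).1 hpow
    refine (QuotientGroup.eq_one_iff _).2 ⟨⟨n, hn⟩, mem_intKernel.2 fun ψ => ?_, rfl⟩
    have hx' : x = ⟨n, hn⟩ ^ k := Subtype.ext hxn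
    have h := mem_intKernel.1 hx ψ
    rw [hx', map_pow] at h
    exact (pow_eq_one_iff_left hk.ne').1 h

theorem hom_eq_one_of_finite_range {I : Subgroup M} [I.Normal]
    (hM : ∀ (Q : Type u) [Group Q] (T : Subgroup Q) (p : M →* Q), IsLatticeLike T →
      I ≤ T.comap p → Finite p.range)
    (G : Subgroup M) (hfi : G.FiniteIndex) (hI : I ≤ G) (φ : G →* Multiplicative ℤ) : φ = 1 := by
  let N := G.normalCore
  have hIN : I ≤ N := Subgroup.normal_le_normalCore.2 hI
  let p := QuotientGroup.mk' ((intKernel N).map N.subtype)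
  have hT : IsLatticeLike (N.map p) := isLatticeLike_map_mk N
  have hfin : Finite p.range := hM _ _ p hT
    (hIN.trans (Subgroup.le_comap_map p N))
  have hN : ∀ n : N, φ ⟨n, G.normalCore_le n.2⟩ = 1 := by
    intro n
    have h1 := hT.torsionFree (p n) ⟨n, n.2, rfl⟩ (isOfFinOrder_apply_of_finite_range hfin _)
    obtain ⟨x, hx, hxn⟩ := (QuotientGroup.eq_one_iff _).1 h1
    obtain rfl : x = n := Subtype.ext hxn
    exact mem_intKernel.1 hx (φ.comp (Subgroup.inclusion G.normalCore_le))
  refine MonoidHom.ext fun g => ?_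
  have h := hN ⟨_, N.pow_index_mem (g : M)⟩
  have h' : φ (g ^ N.index) = 1 := h
  rw [map_pow] at h'
  exact (pow_eq_one_iff_left Subgroup.FiniteIndex.index_ne_zero).1 h'

end Vanishing

theorem ActsTrivially.congr {A B : Type*} [Group A] [Group B] (e : A ≃* B) {α : MulAut A}
    (hα : ActsTrivially α) : ActsTrivially (MulAut.congr e α) := by
  intro g
  have h := congrArg (Abelianization.map e.toMonoidHom) (hα (e.symm g))
  rw [Abelianization.map_of, Abelianization.map_of] at h
  exact h.trans (congrArg Abelianization.of (e.apply_symm_apply g))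

theorem mem_IA_iff {U : Type} {Γ : SimpleGraph U} {α : MulAut (Raag Γ)} :
    α ∈ IA Γ ↔ ActsTrivially α := by
  refine ⟨fun h g => DFunLike.congr_fun (MonoidHom.mem_ker.1 h) (Abelianization.of g), fun h => ?_⟩
  refine MonoidHom.mem_ker.2 (MulEquiv.ext fun x => ?_)
  obtain ⟨g, rfl⟩ := QuotientGroup.mk_surjective x
  exact h g

section Combinatorics

variable {U : Type} (Γ : SimpleGraph U)

/-- The vertices adjacent to all other vertices. -/
def IsCentral (v : U) : Prop := ∀ w, w ≠ v → Γ.Adj v w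

/-- The vertices adjacent to all other vertices. -/
abbrev CentralVertex := {v : U // IsCentral Γ v}

/-- The vertices not adjacent to all other vertices. -/
abbrev NoncentralVertex := {v : U // ¬ IsCentral Γ v}

variable {Γ}

theorem B1.not_adj_trans (hB1 : B1 Γ) {u v w : U} (huv : ¬ Γ.Adj u v) (hvw : ¬ Γ.Adj v w) :
    ¬ Γ.Adj u w := by
  intro huw
  by_cases h : u = v
  · exact hvw (h ▸ huw)
  rcases (hB1 u v h huv).1 huw with rfl | h'
  · exact huv huw
  · exact hvw h'

/-- Non-adjacency of non-central vertices. -/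
def nonadjSetoid (hB1 : B1 Γ) : Setoid (NoncentralVertex Γ) where
  r u v := ¬ Γ.Adj u v
  iseqv :=
    { refl := fun _ => Γ.loopless.irrefl _
      symm := fun h h' => h h'.symm
      trans := hB1.not_adj_trans }

/-- The parts of the multipartite graph spanned by the non-central vertices. -/
abbrev Part (hB1 : B1 Γ) := Quotient (nonadjSetoid hB1)

/-- The vertices of a part. -/
abbrev PartVertex (hB1 : B1 Γ) (i : Part hB1) := {v : NoncentralVertex Γ // ⟦v⟧ = i}

theorem exists_central_ne_ne (hB2 : B2 Γ) (i j : CentralVertex Γ) (hij : i ≠ j) :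
    ∃ k, k ≠ i ∧ k ≠ j := by
  obtain ⟨u, hui, huj, hiu, -⟩ := hB2 i j (fun h => hij (Subtype.ext h)) fun w _ => by
    by_cases hw : w = j
    · exact Or.inl hw
    · exact Or.inr (j.2 w hw)
  refine ⟨⟨u, fun w hw => ?_⟩, fun h => hui (congrArg Subtype.val h),
    fun h => huj (congrArg Subtype.val h)⟩
  by_cases hwi : w = i
  · rw [hwi]
    exact (i.2 u hui).symm
  · exact (hiu (i.2 w hwi)).resolve_left hw

theorem exists_not_adj_ne_ne (hB1 : B1 Γ) (hB2 : B2 Γ) {v w : U} (hv : ¬ IsCentral Γ v)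
    (hvw : ¬ Γ.Adj v w) : ∃ u, u ≠ v ∧ u ≠ w ∧ ¬ Γ.Adj v u := by
  by_cases h : v = w
  · subst h
    simp only [IsCentral, not_forall] at hv
    obtain ⟨u, hu, hvu⟩ := hv
    exact ⟨u, hu, hu, hvu⟩
  · obtain ⟨u, huv, huw, -, hle⟩ := hB2 v w h (hB1 v w h hvw).1
    refine ⟨u, huv, huw, fun hadj => ?_⟩
    rcases hle hadj.symm with h' | h'
    · exact h h'
    · exact hvw h'.symm

theorem exists_partVertex_ne_ne (hB1 : B1 Γ) (hB2 : B2 Γ) (i : Part hB1)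
    (j k : PartVertex hB1 i) : ∃ l, l ≠ j ∧ l ≠ k := by
  have hjk : ¬ Γ.Adj j.1 k.1 := Quotient.exact (j.2.trans k.2.symm)
  obtain ⟨u, huj, huk, hu⟩ := exists_not_adj_ne_ne hB1 hB2 j.1.2 hjk
  refine ⟨⟨⟨u, fun h => hu (h _ huj.symm).symm⟩, ?_⟩, fun h => huj (congrArg (fun x => x.1.1) h),
    fun h => huk (congrArg (fun x => x.1.1) h)⟩
  refine Eq.trans (Quotient.sound fun h => ?_) j.2
  exact hu h.symm

end Combinatorics

section Decomposition

variable {U : Type} {Γ : SimpleGraph U} (hB1 : B1 Γ)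

open Classical in
/-- The image of a generator in the direct product of a free abelian group and free groups. -/
noncomputable def genImage (v : U) : FreeProd (CentralVertex Γ) (PartVertex hB1) :=
  if h : IsCentral Γ v then (Multiplicative.ofAdd (Pi.single ⟨v, h⟩ 1), 1)
  else (1, Pi.mulSingle ⟦⟨v, h⟩⟧ (FreeGroup.of ⟨⟨v, h⟩, rfl⟩))

open Classical in
theorem commute_genImage {u v : U} (h : Γ.Adj u v) :
    Commute (genImage hB1 u) (genImage hB1 v) := by
  unfold genImage
  split_ifs with hu hv hv
  · exact Prod.ext (mul_comm _ _) rfl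
  · exact Prod.ext (mul_comm _ _) (by simp)
  · exact Prod.ext (mul_comm _ _) (by simp)
  · refine Prod.ext rfl (Pi.mulSingle_commute (fun he => ?_) _ _)
    exact Quotient.exact he h

/-- The decomposition homomorphism. -/
noncomputable def decompHom : Raag Γ →* FreeProd (CentralVertex Γ) (PartVertex hB1) :=
  PresentedGroup.toGroup (f := genImage hB1) (by
    rintro _ ⟨u, v, h, rfl⟩
    simp only [map_mul, map_inv, FreeGroup.lift_apply_of]
    rw [(commute_genImage hB1 h).eq]
    group)

theorem decompHom_gen (v : U) : decompHom hB1 (gen Γ v) = genImage hB1 v :=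
  PresentedGroup.toGroup.of _

theorem decompHom_surjective [Finite U] : Function.Surjective (decompHom hB1) := by
  classical
  have := Fintype.ofFinite (CentralVertex Γ)
  rw [← MonoidHom.range_eq_top, eq_top_iff]
  rintro ⟨z, f⟩ -
  have hz : z ∈ (decompHom hB1).range.comap (MonoidHom.inl _ _) := by
    have : z = ∏ c, Multiplicative.ofAdd (Pi.single c 1 : CentralVertex Γ → ℤ) ^ (z.toAdd c) := by
      refine Multiplicative.toAdd.injective ?_
      rw [toAdd_prod]
      simp only [toAdd_zpow, toAdd_ofAdd, ← Pi.single_smul, smul_eq_mul, mul_one]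
      exact (Finset.univ_sum_single _).symm
    rw [this]
    refine Subgroup.prod_mem _ fun c _ => Subgroup.zpow_mem _ ?_ _
    exact ⟨gen Γ c, by rw [decompHom_gen, genImage, dif_pos c.2]; rfl⟩
  have hf : f ∈ (decompHom hB1).range.comap (MonoidHom.inr _ _) := by
    refine Subgroup.pi_mem_of_mulSingle_mem f fun i => ?_
    have : (⊤ : Subgroup (FreeGroup (PartVertex hB1 i))) ≤
        ((decompHom hB1).range.comap (MonoidHom.inr _ _)).comap
          (MonoidHom.mulSingle (fun i => FreeGroup (PartVertex hB1 i)) i) := by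
      rw [← FreeGroup.closure_range_of, Subgroup.closure_le]
      rintro _ ⟨⟨v, rfl⟩, rfl⟩
      exact ⟨gen Γ v, by rw [decompHom_gen, genImage, dif_neg v.2]; rfl⟩
    exact this (Subgroup.mem_top (f i))
  have h := mul_mem (Subgroup.mem_comap.1 hz) (Subgroup.mem_comap.1 hf)
  simpa using h

theorem commute_gen {u v : U} (h : Γ.Adj u v) : Commute (gen Γ u) (gen Γ v) := by
  have h1 : (PresentedGroup.mk (Rels Γ)) (FreeGroup.of u * FreeGroup.of v *
      (FreeGroup.of u)⁻¹ * (FreeGroup.of v)⁻¹) = 1 :=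
    PresentedGroup.one_of_mem ⟨u, v, h, rfl⟩
  rw [map_mul, map_mul, map_mul, map_inv, map_inv, mul_inv_eq_one, mul_inv_eq_iff_eq_mul] at h1
  exact h1

theorem gen_mem_center (c : CentralVertex Γ) : gen Γ c ∈ Subgroup.center (Raag Γ) := by
  have h : (⊤ : Subgroup (Raag Γ)) ≤ Subgroup.centralizer {gen Γ c} := by
    rw [← PresentedGroup.closure_range_of, Subgroup.closure_le]
    rintro _ ⟨v, rfl⟩
    refine Subgroup.mem_centralizer_singleton_iff.2 ?_
    by_cases hv : v = c
    · rw [hv]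
      rfl
    · exact (commute_gen (c.2 v hv)).symm.eq
  exact Subgroup.mem_center_iff.2 fun g =>
    Subgroup.mem_centralizer_singleton_iff.1 (h (Subgroup.mem_top g))

open scoped IsMulCommutative in
/-- The homomorphism from the free abelian group on the central vertices. -/
def centralHom (Γ : SimpleGraph U) [Fintype (CentralVertex Γ)] :
    Multiplicative (CentralVertex Γ → ℤ) →* Subgroup.center (Raag Γ) where
  toFun z := ∏ c : CentralVertex Γ,
    (⟨gen Γ c, gen_mem_center c⟩ : Subgroup.center (Raag Γ)) ^ z.toAdd c
  map_one' := by simp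
  map_mul' z w := by simp [zpow_add, Finset.prod_mul_distrib]

open scoped IsMulCommutative in
theorem centralHom_single [Fintype (CentralVertex Γ)] [DecidableEq (CentralVertex Γ)]
    (c : CentralVertex Γ) :
    (centralHom Γ (Multiplicative.ofAdd (Pi.single c 1)) : Raag Γ) = gen Γ c := by
  change ((∏ d : CentralVertex Γ, (⟨gen Γ d, gen_mem_center d⟩ : Subgroup.center (Raag Γ)) ^
    (Pi.single c 1 : CentralVertex Γ → ℤ) d : Subgroup.center (Raag Γ)) : Raag Γ) = gen Γ c
  rw [Finset.prod_eq_single c (fun d _ hd => by simp [hd]) (by simp)]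
  simp

theorem commute_lift_gen {i j : Part hB1} (hij : i ≠ j) (x : FreeGroup (PartVertex hB1 i))
    (y : FreeGroup (PartVertex hB1 j)) :
    Commute (FreeGroup.lift (fun v => gen Γ v.1.1) x) (FreeGroup.lift (fun v => gen Γ v.1.1) y) := by
  have hgen : ∀ (u : PartVertex hB1 i) (v : PartVertex hB1 j),
      Commute (gen Γ u.1.1) (gen Γ v.1.1) := fun u v =>
    commute_gen (by_contra fun h => hij (u.2.symm.trans ((Quotient.sound h).trans v.2)))
  induction x using FreeGroup.induction_on with
  | C1 => simp
  | of u =>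
    induction y using FreeGroup.induction_on with
    | C1 => simp
    | of v => simpa using hgen u v
    | inv_of v h => simpa using hgen u v
    | mul y z hy hz => rw [map_mul]; exact hy.mul_right hz
  | inv_of u h => rw [map_inv]; exact h.inv_left
  | mul x z hx hz => rw [map_mul]; exact hx.mul_left hz

theorem decompHom_injective [Finite U] : Function.Injective (decompHom hB1) := by
  classical
  have := Fintype.ofFinite (CentralVertex Γ)
  have := Fintype.ofFinite (Part hB1)
  let f : (∀ i, FreeGroup (PartVertex hB1 i)) →* Raag Γ :=
    MonoidHom.noncommPiCoprod (fun i => FreeGroup.lift fun v => gen Γ v.1.1)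
      fun i j hij x y => commute_lift_gen hB1 hij x y
  let g : FreeProd (CentralVertex Γ) (PartVertex hB1) →* Raag Γ :=
    MonoidHom.noncommCoprod ((Subgroup.center (Raag Γ)).subtype.comp (centralHom Γ)) f
      fun z x => ((Subgroup.mem_center_iff.1 (centralHom Γ z).2) (f x)).symm
  have hgf : g.comp (decompHom hB1) = MonoidHom.id _ := by
    refine PresentedGroup.ext fun v => ?_
    change g (decompHom hB1 (gen Γ v)) = gen Γ v
    rw [decompHom_gen, genImage]
    split_ifs with h
    · change (centralHom Γ _ : Raag Γ) * f 1 = _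
      rw [map_one, mul_one]
      exact centralHom_single ⟨v, h⟩
    · change (centralHom Γ 1 : Raag Γ) * f _ = _
      rw [map_one, OneMemClass.coe_one, one_mul]
      exact (MonoidHom.noncommPiCoprod_mulSingle _ _ _).trans FreeGroup.lift_apply_of
  exact Function.LeftInverse.injective (g := g) (DFunLike.congr_fun hgf)

theorem nonempty_mulEquiv_freeProd [Finite U] :
    Nonempty (Raag Γ ≃* FreeProd (CentralVertex Γ) (PartVertex hB1)) :=
  ⟨MulEquiv.ofBijective (decompHom hB1) ⟨decompHom_injective hB1, decompHom_surjective hB1⟩⟩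

end Decomposition

theorem first_cohomology_vanishes_of_propertyB (Γ : SimpleGraph V)
    (hB1 : B1 Γ) (hB2 : B2 Γ)
    (G : Subgroup (MulAut (Raag Γ))) (hfi : G.FiniteIndex) (hIA : IA Γ ≤ G) :
    ∀ φ : G →* Multiplicative ℤ, φ = 1 := by
  classical
  obtain ⟨e⟩ := nonempty_mulEquiv_freeProd hB1
  have := Fintype.ofFinite (Part hB1)
  have : (IA Γ).Normal := MonoidHom.normal_ker _
  refine hom_eq_one_of_finite_range (I := IA Γ) (fun Q _ T p hT hp => ?_) G hfi hIA
  have hfin : Finite (p.comp (MulAut.congr e.symm).toMonoidHom).range :=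
    finite_range_mulAut_freeProd hT (fun α hα => hp (mem_IA_iff.2 (hα.congr e.symm)))
      (fun i => Quotient.inductionOn i fun v => ⟨⟨v, rfl⟩⟩)
      (exists_partVertex_ne_ne hB1 hB2) (exists_central_ne_ne hB2)
  refine ((Set.finite_coe_iff.1 hfin).subset ?_).to_subtype
  rintro _ ⟨α, rfl⟩
  exact ⟨MulAut.congr e α, congrArg p ((MulAut.congr e).symm_apply_apply α)⟩

end RaagPaper
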